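/- arXiv:2406.12461 — 2 statements merged into one kernel-verified Lean document; each statement's English description precedes it below -/
import Mathlib

section
/- Let d ≥ 1, L > 0, μ ≥ 0, λ > 0, and let 𝑣 = (v_1,…,v_N) be a volume vector with ∑_i v_i = L^d. Define P_* := inf_G inf_D inf{ μ·Per_K(D) + ∑_{i=1}^N ( (1/2)·Per_K(E_i) + λ·| |E_i| − v_i | ) : E_i ⊆ D Borel, |E_i ∩ E_j| = 0 for i ≠ j, |D ∖ ⋃_i E_i| = 0 }, where the infima run over all lattices G in ℝ^d with d(G) = L^d and all fundamental domains D for G, and Per_K is the nonlocal perimeter (no volume constraint is imposed on the E_i). Then there exist a lattice G with d(G) = L^d, a fundamental domain D for G, and an admissible partition (E_1,…,E_N) of D such that P_* = μ·Per_K(D) + ∑_i ( (1/2)·Per_K(E_i) + λ·| |E_i| − v_i | ). -/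
open MeasureTheory Filter Topology
open scoped symmDiff ENNReal

noncomputable section

variable {d : ℕ}

abbrev Vd (d : ℕ) := EuclideanSpace ℝ (Fin d)

def nlPer (K : Vd d → ℝ≥0∞) (E : Set (Vd d)) : ℝ≥0∞ :=
  ∫⁻ x in E, ∫⁻ y in Eᶜ, K (x - y)

def nlPerRel (K : Vd d → ℝ≥0∞) (E Ω : Set (Vd d)) : ℝ≥0∞ :=
  (∫⁻ x in E ∩ Ω, ∫⁻ y in Eᶜ, K (x - y)) + (∫⁻ x in E \ Ω, ∫⁻ y in Ω \ E, K (x - y))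

def IsKernelBase (K : Vd d → ℝ≥0∞) : Prop :=
  Measurable K ∧ (∀ x, K (-x) = K x) ∧ (∫⁻ x, ENNReal.ofReal (min 1 ‖x‖) * K x) < ⊤

def IsKernel (s C : ℝ) (K : Vd d → ℝ≥0∞) : Prop :=
  IsKernelBase K ∧ ∀ x : Vd d, x ≠ 0 → ENNReal.ofReal (C * ‖x‖ ^ (-(d : ℝ) - s)) ≤ K x

def latticeOf (b : Fin d → Vd d) : Set (Vd d) :=
  {x | ∃ k : Fin d → ℤ, x = ∑ i, (k i : ℝ) • b i}

def IsLattice (G : Set (Vd d)) : Prop :=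
  ∃ b : Fin d → Vd d, LinearIndependent ℝ b ∧ G = latticeOf b

def IsLatticeWithVol (G : Set (Vd d)) (vol : ℝ) : Prop :=
  ∃ b : Fin d → Vd d, LinearIndependent ℝ b ∧ G = latticeOf b ∧
    |Matrix.det (Matrix.of fun i j => b j i)| = vol

def setTranslate (g : Vd d) (A : Set (Vd d)) : Set (Vd d) := (fun x => x + g) '' A

def IsFundDom (G : Set (Vd d)) (D : Set (Vd d)) : Prop :=
  MeasurableSet D ∧ (∀ g ∈ G, g ≠ 0 → volume (setTranslate g D ∩ D) = 0) ∧
    volume (Set.univ \ ⋃ g ∈ G, setTranslate g D) = 0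

def packingRadius (G : Set (Vd d)) : ℝ :=
  sSup {r : ℝ | 0 < r ∧ ∀ g₁ ∈ G, ∀ g₂ ∈ G, g₁ ≠ g₂ →
    Disjoint (Metric.ball g₁ r) (Metric.ball g₂ r)}

def phiK (K : Vd d → ℝ≥0∞) (t : ℝ) : ℝ≥0∞ := ∫⁻ x in (Metric.ball (0 : Vd d) t)ᶜ, K x

def setDist (A B : Set (Vd d)) : ℝ := sInf ((fun p : Vd d × Vd d => dist p.1 p.2) '' (A ×ˢ B))

def TendstoL1loc (E : ℕ → Set (Vd d)) (F : Set (Vd d)) : Prop :=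
  ∀ R : ℝ, 0 < R → Tendsto (fun n => volume ((E n ∆ F) ∩ Metric.ball 0 R)) atTop (𝓝 0)

def AdmissiblePart (D : Set (Vd d)) {N : ℕ} (v : Fin N → ℝ) (E : Fin N → Set (Vd d)) : Prop :=
  (∀ i, MeasurableSet (E i)) ∧ (∀ i, E i ⊆ D) ∧
  (∀ i, volume (E i) = ENNReal.ofReal (v i)) ∧
  (∀ i j, i ≠ j → volume (E i ∩ E j) = 0) ∧
  volume (D \ ⋃ i, E i) = 0

def AdmissiblePart₀ (D : Set (Vd d)) {N : ℕ} (E : Fin N → Set (Vd d)) : Prop :=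
  (∀ i, MeasurableSet (E i)) ∧ (∀ i, E i ⊆ D) ∧
  (∀ i j, i ≠ j → volume (E i ∩ E j) = 0) ∧
  volume (D \ ⋃ i, E i) = 0

def ediff (a b : ℝ≥0∞) : ℝ≥0∞ := (a - b) + (b - a)

def IsPartition {J : Type*} (A : J → Set (Vd d)) : Prop :=
  (∀ j, MeasurableSet (A j)) ∧ (∀ j j', j ≠ j' → volume (A j ∩ A j') = 0) ∧
  volume (Set.univ \ ⋃ j, A j) = 0

def ComptContained (S Ω : Set (Vd d)) : Prop := IsCompact (closure S) ∧ closure S ⊆ Ω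

def IsVolConstrMin (K : Vd d → ℝ≥0∞) (Λ : ℝ≥0∞) (Ω : Set (Vd d))
    {J : Type*} (A : J → Set (Vd d)) : Prop :=
  (∑' j, nlPerRel K (A j) Ω) ≠ ⊤ ∧
  ∀ B : J → Set (Vd d), IsPartition B →
    (∀ j, ComptContained (A j ∆ B j) Ω) →
    (∀ j, volume (A j ∩ Ω) = volume (B j ∩ Ω)) →
    (∑' j, nlPerRel K (A j) Ω) ≤ ∑' j, (nlPerRel K (B j) Ω + Λ * volume (A j ∆ B j))

def IsLamMin (K : Vd d → ℝ≥0∞) (Λ : ℝ≥0∞) (Ω : Set (Vd d))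
    {J : Type*} (A : J → Set (Vd d)) : Prop :=
  (∑' j, nlPerRel K (A j) Ω) ≠ ⊤ ∧
  ∀ B : J → Set (Vd d), IsPartition B →
    (∀ j, ComptContained (A j ∆ B j) Ω) →
    (∑' j, nlPerRel K (A j) Ω) ≤ ∑' j, (nlPerRel K (B j) Ω + Λ * volume (A j ∆ B j))

lemma nlPer_compl {K : Vd d → ℝ≥0∞} (hK : IsKernelBase K) (A : Set (Vd d)) :
    nlPer K Aᶜ = nlPer K A := by
  obtain ⟨hm, hsym, -⟩ := hK
  unfold nlPer
  rw [compl_compl, lintegral_lintegral_swap]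
  · refine lintegral_congr fun x => lintegral_congr fun y => ?_
    rw [← hsym, neg_sub]
  · exact (hm.comp (measurable_fst.sub measurable_snd)).aemeasurable

lemma nlPer_translate (K : Vd d → ℝ≥0∞) (g : Vd d) (A : Set (Vd d)) :
    nlPer K ((· + g) ⁻¹' A) = nlPer K A := by
  have hg := measurePreserving_add_right (volume : Measure (Vd d)) g
  have he := measurableEmbedding_addRight g
  unfold nlPer
  rw [← hg.setLIntegral_comp_preimage_emb he _ A]
  refine lintegral_congr fun x => ?_
  rw [← Set.preimage_compl, ← hg.setLIntegral_comp_preimage_emb he _ Aᶜ]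
  simp

lemma nlPer_congr_ae (K : Vd d → ℝ≥0∞) {A B : Set (Vd d)} (h : A =ᵐ[volume] B) :
    nlPer K A = nlPer K B := by
  unfold nlPer
  rw [setLIntegral_congr h]
  refine lintegral_congr fun x => ?_
  rw [setLIntegral_congr h.compl]

lemma nlPer_iUnion_le {Q : Type*} [Countable Q] (K : Vd d → ℝ≥0∞) (A : Q → Set (Vd d)) :
    nlPer K (⋃ q, A q) ≤ ∑' q, nlPer K (A q) := by
  unfold nlPer
  refine (lintegral_iUnion_le _ _).trans (ENNReal.tsum_le_tsum fun q => ?_)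
  refine lintegral_mono fun x => lintegral_mono_set ?_
  exact Set.compl_subset_compl.2 (Set.subset_iUnion A q)

/-- At scale `ρ`, the nonlocal perimeter controls how often a ball centred in `A` leaves `A`. -/
lemma ball_energy_le {s C : ℝ} (hs : 0 < s) (hC : 0 < C) {K : Vd d → ℝ≥0∞} (hK : IsKernel s C K)
    {A : Set (Vd d)} (hA : MeasurableSet A) {ρ : ℝ} :
    ENNReal.ofReal (C * ρ ^ (-(d : ℝ) - s)) *
      ∫⁻ x in A, volume (Metric.ball x ρ ∩ Aᶜ) ≤ nlPer K A := by
  unfold nlPer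
  rw [← lintegral_const_mul' _ _ ENNReal.ofReal_ne_top]
  refine setLIntegral_mono' hA fun x hx => ?_
  rw [← setLIntegral_const]
  refine le_trans ?_ (lintegral_mono_set (s := Metric.ball x ρ ∩ Aᶜ) Set.inter_subset_right)
  refine setLIntegral_mono' (Metric.isOpen_ball.measurableSet.inter hA.compl) fun y hy => ?_
  have hxy : x - y ≠ 0 := by
    rintro h
    rw [sub_eq_zero] at h
    exact hy.2 (h ▸ hx)
  refine le_trans (ENNReal.ofReal_le_ofReal ?_) (hK.2 _ hxy)
  refine mul_le_mul_of_nonneg_left ?_ hC.le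
  refine Real.rpow_le_rpow_of_nonpos (norm_pos_iff.2 hxy) ?_ ?_
  · have := hy.1
    rw [Metric.mem_ball, dist_comm, dist_eq_norm] at this
    exact this.le
  · have : (0 : ℝ) ≤ d := Nat.cast_nonneg d
    linarith

/-- The part of the perimeter of `A` seen inside the ball of radius `m`, with `K` capped at `m`. -/
def cappedPer (K : Vd d → ℝ≥0∞) (m : ℕ) (A : Set (Vd d)) : ℝ≥0∞ :=
  ∫⁻ p in (A ∩ Metric.ball 0 m) ×ˢ (Aᶜ ∩ Metric.ball 0 m), min (K (p.1 - p.2)) m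
    ∂((volume : Measure (Vd d)).prod volume)

lemma nlPer_eq_setLIntegral_prod {K : Vd d → ℝ≥0∞} (hK : Measurable K) (A : Set (Vd d)) :
    nlPer K A = ∫⁻ p in A ×ˢ Aᶜ, K (p.1 - p.2) ∂((volume : Measure (Vd d)).prod volume) := by
  rw [← Measure.prod_restrict, lintegral_prod]
  · rfl
  · exact (hK.comp (measurable_fst.sub measurable_snd)).aemeasurable

lemma iSup_cappedPer {K : Vd d → ℝ≥0∞} (hK : Measurable K) {A : Set (Vd d)}
    (hA : MeasurableSet A) : nlPer K A = ⨆ m, cappedPer K m A := by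
  have hms : ∀ m : ℕ, MeasurableSet
      ((A ∩ Metric.ball (0 : Vd d) m) ×ˢ (Aᶜ ∩ Metric.ball (0 : Vd d) m)) := fun m =>
    (hA.inter Metric.isOpen_ball.measurableSet).prod
      (hA.compl.inter Metric.isOpen_ball.measurableSet)
  have hK' : Measurable fun p : Vd d × Vd d => K (p.1 - p.2) :=
    hK.comp (measurable_fst.sub measurable_snd)
  rw [nlPer_eq_setLIntegral_prod hK]
  unfold cappedPer
  simp_rw [← lintegral_indicator (hms _)]
  rw [← lintegral_indicator (hA.prod hA.compl), ← lintegral_iSup]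
  · refine lintegral_congr fun p => ?_
    by_cases hp : p ∈ A ×ˢ Aᶜ
    · rw [Set.indicator_of_mem hp]
      refine le_antisymm (le_of_forall_lt fun a ha => ?_) (iSup_le fun m => ?_)
      · obtain ⟨n₁, hn₁⟩ := ENNReal.exists_nat_gt ha.ne_top
        obtain ⟨n₂, hn₂⟩ := exists_nat_gt (max ‖p.1‖ ‖p.2‖)
        refine lt_of_lt_of_le ?_ (le_iSup _ (max n₁ n₂))
        rw [Set.indicator_of_mem]
        · refine lt_min ha (hn₁.trans_le ?_)
          exact_mod_cast le_max_left n₁ n₂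
        · have h2 : max ‖p.1‖ ‖p.2‖ < ((max n₁ n₂ : ℕ) : ℝ) :=
            hn₂.trans_le (by exact_mod_cast le_max_right n₁ n₂)
          exact ⟨⟨hp.1, mem_ball_zero_iff.2 ((le_max_left _ _).trans_lt h2)⟩,
            ⟨hp.2, mem_ball_zero_iff.2 ((le_max_right _ _).trans_lt h2)⟩⟩
      · simp only [Set.indicator]
        split_ifs
        exacts [min_le_left _ _, zero_le]
    · rw [Set.indicator_of_notMem hp]
      symm
      rw [ENNReal.iSup_eq_zero]
      intro m
      refine Set.indicator_of_notMem (fun h => hp ⟨h.1.1, h.2.1⟩) _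
  · exact fun m => (hK'.min measurable_const).indicator (hms m)
  · intro m n hmn p
    have hmn' : (m : ℝ) ≤ n := by exact_mod_cast hmn
    refine (Set.indicator_le_indicator (g := fun p : Vd d × Vd d => min (K (p.1 - p.2)) n) ?_).trans
      (Set.indicator_le_indicator_of_subset ?_ (fun _ => zero_le) p)
    · exact min_le_min le_rfl (by exact_mod_cast hmn)
    · exact Set.prod_mono (Set.inter_subset_inter_right _ (Metric.ball_subset_ball hmn'))
        (Set.inter_subset_inter_right _ (Metric.ball_subset_ball hmn'))

lemma cappedPer_mono {K : Vd d → ℝ≥0∞} (A : Set (Vd d)) : Monotone fun m => cappedPer K m A := by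
  intro m n hmn
  have hmn' : (m : ℝ) ≤ n := by exact_mod_cast hmn
  refine (lintegral_mono_set ?_).trans (lintegral_mono fun p => ?_)
  · exact Set.prod_mono (Set.inter_subset_inter_right _ (Metric.ball_subset_ball hmn'))
      (Set.inter_subset_inter_right _ (Metric.ball_subset_ball hmn'))
  · exact min_le_min le_rfl (by exact_mod_cast hmn)

lemma cappedPer_le_add (K : Vd d → ℝ≥0∞) (m : ℕ) (A F : Set (Vd d)) :
    cappedPer K m F ≤ cappedPer K m A +
      2 * (m * volume (Metric.ball (0 : Vd d) m)) * volume ((A ∆ F) ∩ Metric.ball 0 m) := by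
  set B := Metric.ball (0 : Vd d) m
  have hsub : (F ∩ B) ×ˢ (Fᶜ ∩ B) ⊆
      (A ∩ B) ×ˢ (Aᶜ ∩ B) ∪ (((A ∆ F) ∩ B) ×ˢ B ∪ B ×ˢ ((A ∆ F) ∩ B)) := by
    rintro ⟨x, y⟩ ⟨⟨hx, hxB⟩, ⟨hy, hyB⟩⟩
    simp only [Set.mem_union, Set.mem_prod, Set.mem_inter_iff, Set.mem_symmDiff,
      Set.mem_compl_iff] at *
    tauto
  have hc : ∀ S : Set (Vd d × Vd d), ∫⁻ p in S, min (K (p.1 - p.2)) m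
      ∂((volume : Measure (Vd d)).prod volume) ≤ m * ((volume : Measure (Vd d)).prod volume) S := by
    intro S
    rw [← setLIntegral_const]
    exact lintegral_mono fun p => min_le_right _ _
  unfold cappedPer
  refine (lintegral_mono_set hsub).trans ((lintegral_union_le _ _ _).trans ?_)
  gcongr
  refine (lintegral_union_le _ _ _).trans ((add_le_add (hc _) (hc _)).trans_eq ?_)
  rw [Measure.prod_prod, Measure.prod_prod]
  ring

lemma cappedPer_translate_le {K : Vd d → ℝ≥0∞} (m : ℕ) (A : Set (Vd d))
    (g : Vd d) : cappedPer K m ((· + g) ⁻¹' A) ≤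
      ∫⁻ p in (A ∩ Metric.ball g m) ×ˢ (Aᶜ ∩ Metric.ball g m), K (p.1 - p.2)
        ∂((volume : Measure (Vd d)).prod volume) := by
  have hg := (measurePreserving_add_right (volume : Measure (Vd d)) g).prod
    (measurePreserving_add_right (volume : Measure (Vd d)) g)
  have he : MeasurableEmbedding (Prod.map (· + g) (· + g) : Vd d × Vd d → Vd d × Vd d) :=
    (measurableEmbedding_addRight g).prodMap (measurableEmbedding_addRight g)
  rw [← hg.setLIntegral_comp_preimage_emb he]
  unfold cappedPer
  refine (lintegral_mono_set ?_).trans (lintegral_mono fun p => ?_)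
  · rintro ⟨x, y⟩ ⟨⟨hx, hxB⟩, ⟨hy, hyB⟩⟩
    simp only [mem_ball_zero_iff] at hxB hyB
    exact ⟨⟨hx, by simpa [dist_eq_norm] using hxB⟩, ⟨hy, by simpa [dist_eq_norm] using hyB⟩⟩
  · simp

/-- Lower semicontinuity of the perimeter along profiles that drift infinitely far apart. -/
lemma tsum_nlPer_le_of_profiles {K : Vd d → ℝ≥0∞} (hK : Measurable K) {l : Filter ℕ} [l.NeBot]
    {Q : Type*} {A : ℕ → Set (Vd d)} (hA : ∀ n, MeasurableSet (A n))
    {g : Q → ℕ → Vd d}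
    (hsep : ∀ q q', q ≠ q' → ∀ R : ℝ, ∀ᶠ n in l, R < dist (g q n) (g q' n))
    {F : Q → Set (Vd d)} (hF : ∀ q, MeasurableSet (F q))
    (hlim : ∀ q (R : ℝ), Tendsto
      (fun n => volume ((((· + g q n) ⁻¹' A n) ∆ F q) ∩ Metric.ball 0 R)) l (𝓝 0))
    {M : ℝ≥0∞} (hM : ∀ᶠ n in l, nlPer K (A n) ≤ M) : ∑' q, nlPer K (F q) ≤ M := by
  classical
  rw [ENNReal.tsum_eq_iSup_sum]
  refine iSup_le fun S => ?_
  simp_rw [iSup_cappedPer hK (hF _)]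
  rw [ENNReal.finsetSum_iSup_of_monotone fun q => cappedPer_mono (F q)]
  refine iSup_le fun m => ?_
  set c : ℝ≥0∞ := 2 * (m * volume (Metric.ball (0 : Vd d) m)) with hc
  have hcTop : c ≠ ⊤ := by
    have : volume (Metric.ball (0 : Vd d) m) ≠ ⊤ := measure_ball_lt_top.ne
    finiteness
  have hT : Tendsto (fun n => M + ∑ q ∈ S, c *
      volume ((((· + g q n) ⁻¹' A n) ∆ F q) ∩ Metric.ball 0 m)) l (𝓝 (M + ∑ q ∈ S, c * 0)) := by
    refine tendsto_const_nhds.add (tendsto_finsetSum _ fun q _ => ?_)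
    exact ENNReal.Tendsto.const_mul (hlim q m) (Or.inr hcTop)
  simp only [mul_zero, Finset.sum_const_zero, add_zero] at hT
  refine ge_of_tendsto hT ?_
  have hsep' : ∀ᶠ n in l, ∀ q ∈ S, ∀ q' ∈ S, q ≠ q' → (2 * m : ℝ) < dist (g q n) (g q' n) := by
    refine (eventually_all_finset _).2 fun q _ => (eventually_all_finset _).2 fun q' _ => ?_
    by_cases h : q = q'
    · simp [h]
    · filter_upwards [hsep q q' h (2 * m)] with n hn _ using hn
  filter_upwards [hM, hsep'] with n hMn hn
  refine (Finset.sum_le_sum fun q _ => cappedPer_le_add K m ((· + g q n) ⁻¹' A n) (F q)).trans ?_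
  rw [Finset.sum_add_distrib]
  refine add_le_add ?_ le_rfl
  refine le_trans (Finset.sum_le_sum fun q _ => cappedPer_translate_le m (A n) (g q n)) ?_
  refine le_trans ?_ hMn
  rw [nlPer_eq_setLIntegral_prod hK, ← lintegral_biUnion_finset]
  · refine lintegral_mono_set (Set.iUnion₂_subset fun q _ => ?_)
    exact Set.prod_mono Set.inter_subset_left Set.inter_subset_left
  · intro q hq q' hq' hne
    refine Set.disjoint_left.2 fun p hp hp' => ?_
    have h1 := hn q hq q' hq' hne
    have h2 : dist p.1 (g q n) < m := hp.1.2
    have h3 : dist p.1 (g q' n) < m := hp'.1.2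
    have := dist_triangle_left (g q n) (g q' n) p.1
    linarith
  · exact fun q _ => ((hA n).inter Metric.isOpen_ball.measurableSet).prod
      ((hA n).compl.inter Metric.isOpen_ball.measurableSet)

/-- At small scales, most points of a set of bounded perimeter see little of its complement. -/
lemma exists_scale {s C : ℝ} (hs : 0 < s) (hC : 0 < C) {K : Vd d → ℝ≥0∞} (hK : IsKernel s C K)
    {M : ℝ≥0∞} (hM : M ≠ ⊤) {ε : ℝ≥0∞} (hε : ε ≠ 0) :
    ∃ δ₀ : ℝ, 0 < δ₀ ∧ δ₀ ≤ 1 ∧ ∀ δ, 0 < δ → δ ≤ δ₀ → ∀ A : Set (Vd d), MeasurableSet A →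
      nlPer K A ≤ M →
      volume {x ∈ A | volume (Metric.ball (0 : Vd d) (δ / 2)) / 2 ≤
        volume (Metric.ball x δ ∩ Aᶜ)} ≤ ε := by
  set ω : ℝ := (volume (Metric.ball (0 : Vd d) 1)).toReal with hω
  have hωpos : 0 < ω :=
    ENNReal.toReal_pos (Metric.measure_ball_pos _ _ one_pos).ne' measure_ball_lt_top.ne
  set c : ℝ := 2 * M.toReal * 2 ^ d / (C * ω) with hc
  have hc0 : 0 ≤ c := by positivity
  have hvol : ∀ δ : ℝ, 0 < δ →
      volume (Metric.ball (0 : Vd d) (δ / 2)) = ENNReal.ofReal ((δ / 2) ^ d * ω) := by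
    intro δ hδ
    rw [Measure.addHaar_ball_of_pos _ _ (by positivity), ENNReal.ofReal_mul (by positivity),
      ENNReal.ofReal_toReal measure_ball_lt_top.ne]
    simp
  have key : ∀ δ : ℝ, 0 < δ → ∀ A : Set (Vd d), MeasurableSet A → nlPer K A ≤ M →
      volume {x ∈ A | volume (Metric.ball (0 : Vd d) (δ / 2)) / 2 ≤
        volume (Metric.ball x δ ∩ Aᶜ)} ≤ ENNReal.ofReal (c * δ ^ s) := by
    intro δ hδ A hA hAM
    have hmeas : Measurable fun x : Vd d => volume (Metric.ball x δ ∩ Aᶜ) := by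
      have hS : MeasurableSet {p : Vd d × Vd d | dist p.2 p.1 < δ ∧ p.2 ∈ Aᶜ} :=
        (measurableSet_lt (measurable_snd.dist measurable_fst) measurable_const).inter
          (measurable_snd hA.compl)
      exact measurable_measure_prodMk_left hS
    have h1 := ball_energy_le hs hC hK hA (ρ := δ)
    have h2 := mul_meas_ge_le_lintegral (μ := volume.restrict A) hmeas
      (volume (Metric.ball (0 : Vd d) (δ / 2)) / 2)
    rw [Measure.restrict_apply (measurableSet_le measurable_const hmeas), Set.inter_comm] at h2
    set S := A ∩ {x | volume (Metric.ball (0 : Vd d) (δ / 2)) / 2 ≤ volume (Metric.ball x δ ∩ Aᶜ)}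
    have h3 : ENNReal.ofReal (C * δ ^ (-(d : ℝ) - s)) *
        (volume (Metric.ball (0 : Vd d) (δ / 2)) / 2 * volume S) ≤ M :=
      (mul_le_mul_right h2 _).trans (h1.trans hAM)
    change volume S ≤ _
    have hq : volume (Metric.ball (0 : Vd d) (δ / 2)) / 2 =
        ENNReal.ofReal ((δ / 2) ^ d * ω / 2) := by
      rw [hvol δ hδ, ENNReal.ofReal_div_of_pos two_pos, ENNReal.ofReal_ofNat]
    rw [hq, ← mul_assoc, ← ENNReal.ofReal_mul (by positivity),
      ← ENNReal.ofReal_toReal hM] at h3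
    have hp : 0 < C * δ ^ (-(d : ℝ) - s) * ((δ / 2) ^ d * ω / 2) := by positivity
    have h4 : volume S ≤ ENNReal.ofReal (M.toReal) /
        ENNReal.ofReal (C * δ ^ (-(d : ℝ) - s) * ((δ / 2) ^ d * ω / 2)) := by
      rw [ENNReal.le_div_iff_mul_le (Or.inl (by simpa using hp)) (Or.inl ENNReal.ofReal_ne_top),
        mul_comm]
      exact h3
    rw [← ENNReal.ofReal_div_of_pos hp] at h4
    refine h4.trans_eq ?_
    congr 1
    have h5 : δ ^ (-(d : ℝ) - s) = (δ ^ d)⁻¹ * (δ ^ s)⁻¹ := by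
      rw [sub_eq_add_neg, Real.rpow_add hδ, Real.rpow_neg hδ.le, Real.rpow_neg hδ.le,
        Real.rpow_natCast]
    rw [h5, hc, div_pow]
    have : δ ^ s ≠ 0 := by positivity
    field_simp
  obtain ⟨η, hη, hηε⟩ : ∃ η : ℝ, 0 < η ∧ ENNReal.ofReal η ≤ ε := by
    rcases eq_or_ne ε ⊤ with rfl | h
    · exact ⟨1, one_pos, le_top⟩
    · exact ⟨ε.toReal, ENNReal.toReal_pos hε h, by rw [ENNReal.ofReal_toReal h]⟩
  have hlim : Tendsto (fun δ : ℝ => c * δ ^ s) (𝓝[>] 0) (𝓝 (c * 0 ^ s)) :=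
    (((Real.continuousAt_rpow_const 0 s (Or.inr hs.le)).tendsto).const_mul c).mono_left
      nhdsWithin_le_nhds
  rw [Real.zero_rpow hs.ne', mul_zero] at hlim
  obtain ⟨t, ht, ht'⟩ := mem_nhdsGT_iff_exists_Ioo_subset.1 (hlim.eventually (gt_mem_nhds hη))
  have ht0 : (0 : ℝ) < t := ht
  refine ⟨min (t / 2) 1, by positivity, min_le_right _ _, fun δ hδ hδ' A hA hAM => ?_⟩
  refine (key δ hδ A hA hAM).trans (le_trans (ENNReal.ofReal_le_ofReal ?_) hηε)
  have : δ ∈ Set.Ioo 0 t := ⟨hδ, by have := hδ'.trans (min_le_left _ _); linarith⟩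
  exact (show c * δ ^ s < η from ht' this).le

/-- A set of bounded perimeter that is almost disjoint from a translate forces a long translation
vector. -/
lemma exists_packing {s C : ℝ} (hs : 0 < s) (hC : 0 < C) {K : Vd d → ℝ≥0∞} (hK : IsKernel s C K)
    {M V : ℝ≥0∞} (hM : M ≠ ⊤) (hV : V ≠ ⊤) (hV0 : V ≠ 0) :
    ∃ r : ℝ, 0 < r ∧ ∀ D : Set (Vd d), MeasurableSet D → volume D = V → nlPer K D ≤ M →
      ∀ g : Vd d, g ≠ 0 → volume ((· + g) ⁻¹' D ∩ D) = 0 → r ≤ ‖g‖ := by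
  obtain ⟨δ, hδ, -, h⟩ := exists_scale hs hC hK hM (ENNReal.half_pos hV0).ne'
  refine ⟨δ / 2, by positivity, fun D hD hDV hDM g hg hdis => ?_⟩
  by_contra! hlt
  have hg0 : 0 < ‖g‖ := norm_pos_iff.2 hg
  have h1 := h (2 * ‖g‖) (by positivity) (by linarith) D hD hDM
  rw [mul_div_cancel_left₀ _ two_ne_zero] at h1
  have h2 : {x ∈ D | volume (Metric.ball (0 : Vd d) ‖g‖) / 2 ≤
      volume (Metric.ball x (2 * ‖g‖) ∩ Dᶜ)} = D := by
    refine Set.sep_eq_self_iff_mem_true.2 fun x _ => ?_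
    have hsub : Metric.ball x ‖g‖ ⊆ (Metric.ball x (2 * ‖g‖) ∩ Dᶜ) ∪
        ((· + g) ⁻¹' (Metric.ball x (2 * ‖g‖) ∩ Dᶜ)) ∪ ((· + g) ⁻¹' D ∩ D) := by
      intro y hy
      have hy' : dist y x < ‖g‖ := hy
      have e1 : y ∈ Metric.ball x (2 * ‖g‖) := by
        rw [Metric.mem_ball]
        linarith
      have e2 : y + g ∈ Metric.ball x (2 * ‖g‖) := by
        rw [Metric.mem_ball]
        have := dist_triangle (y + g) y x
        simp only [dist_self_add_left] at this
        linarith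
      by_cases a : y ∈ D <;> by_cases b : y + g ∈ D
      · exact Or.inr ⟨b, a⟩
      · exact Or.inl (Or.inr ⟨e2, b⟩)
      · exact Or.inl (Or.inl ⟨e1, a⟩)
      · exact Or.inl (Or.inl ⟨e1, a⟩)
    have hle := (measure_mono (μ := volume) hsub).trans ((measure_union_le _ _).trans
      (add_le_add (measure_union_le _ _) le_rfl))
    rw [hdis, add_zero, measure_preimage_add_right, ← two_mul,
      Measure.addHaar_ball_center] at hle
    exact ENNReal.div_le_of_le_mul' hle
  rw [h2, hDV] at h1
  exact absurd h1 (not_le.2 (ENNReal.half_lt_self hV0 hV))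

/-- A set of bounded perimeter and volume is covered, up to a small error, by a bounded number of
balls of radius two. -/
lemma exists_ball_cover {s C : ℝ} (hs : 0 < s) (hC : 0 < C) {K : Vd d → ℝ≥0∞}
    (hK : IsKernel s C K) {M V : ℝ≥0∞} (hM : M ≠ ⊤) (hV : V ≠ ⊤) {ε : ℝ≥0∞} (hε : ε ≠ 0) :
    ∃ m : ℕ, ∀ A : Set (Vd d), MeasurableSet A → volume A ≤ V → nlPer K A ≤ M →
      ∃ x : Fin m → Vd d, volume (A \ ⋃ i, Metric.ball (x i) 2) ≤ ε := by
  classical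
  obtain ⟨δ, hδ, hδ1, h⟩ := exists_scale hs hC hK hM hε
  set β := volume (Metric.ball (0 : Vd d) (δ / 2)) / 2 with hβ
  have hball0 : volume (Metric.ball (0 : Vd d) (δ / 2)) ≠ 0 :=
    (Metric.measure_ball_pos _ _ (by positivity)).ne'
  have hβ0 : β ≠ 0 := (ENNReal.half_pos hball0).ne'
  obtain ⟨m, hm⟩ : ∃ m : ℕ, V / β < m :=
    ENNReal.exists_nat_gt (ENNReal.div_lt_top hV hβ0).ne
  refine ⟨m, fun A hA hAV hAM => ?_⟩
  set A' := {x ∈ A | β ≤ volume (Metric.ball x δ ∩ A)} with hA'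
  have hcard : ∀ X : Finset (Vd d), ↑X ⊆ A' → (X : Set (Vd d)).PairwiseDisjoint
      (fun x => Metric.ball x δ ∩ A) → X.card ≤ m := by
    intro X hX hXd
    have h1 : (X.card : ℝ≥0∞) * β ≤ V := by
      calc (X.card : ℝ≥0∞) * β = ∑ x ∈ X, β := by simp
        _ ≤ ∑ x ∈ X, volume (Metric.ball x δ ∩ A) := Finset.sum_le_sum fun x hx => (hX hx).2
        _ = volume (⋃ x ∈ X, Metric.ball x δ ∩ A) :=
            (measure_biUnion_finset hXd fun x _ => Metric.isOpen_ball.measurableSet.inter hA).symm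
        _ ≤ volume A := measure_mono (Set.iUnion₂_subset fun x _ => Set.inter_subset_right)
        _ ≤ V := hAV
    have h2 : (X.card : ℝ≥0∞) ≤ V / β := by
      rw [ENNReal.le_div_iff_mul_le (Or.inl hβ0) (Or.inr hV)]
      exact h1
    exact_mod_cast (h2.trans_lt hm).le
  set P : ℕ → Prop := fun k => ∃ X : Finset (Vd d), X.card = k ∧ ↑X ⊆ A' ∧
    (X : Set (Vd d)).PairwiseDisjoint (fun x => Metric.ball x δ ∩ A)
  have hP0 : P 0 := ⟨∅, by simp, by simp, by simp⟩
  obtain ⟨X, hXc, hXA, hXd⟩ := Nat.findGreatest_spec (P := P) (Nat.zero_le m) hP0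
  have hXm := hcard X hXA hXd
  have hmax : ∀ x ∈ A', ∃ y ∈ X, dist x y < 2 := by
    intro x hx
    by_contra! hfar
    have hxX : x ∉ X := fun hxX => by
      have := hfar x hxX
      rw [dist_self] at this
      linarith
    have hins : P (insert x X).card := by
      refine ⟨insert x X, rfl, ?_, ?_⟩
      · rw [Finset.coe_insert]
        exact Set.insert_subset hx hXA
      · rw [Finset.coe_insert]
        refine hXd.insert fun y hy _ => Set.disjoint_left.2 fun z hz hz' => ?_
        have h1 : dist z x < δ := hz.1
        have h2 : dist z y < δ := hz'.1
        have h3 := dist_triangle_left x y z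
        have h4 := hfar y hy
        linarith
    have hle := Nat.le_findGreatest (P := P) (hcard _ hins.choose_spec.2.1 hins.choose_spec.2.2
      |> fun h => hins.choose_spec.1 ▸ h) hins
    rw [Finset.card_insert_of_notMem hxX, hXc] at hle
    omega
  refine ⟨fun i => X.toList.getD i 0, le_trans (measure_mono ?_) (h δ hδ le_rfl A hA hAM)⟩
  rintro x ⟨hxA, hxn⟩
  refine ⟨hxA, ?_⟩
  have hx' : x ∉ A' := by
    intro hxA'
    obtain ⟨y, hy, hxy⟩ := hmax x hxA'
    obtain ⟨i, hi, rfl⟩ := List.getElem_of_mem (Finset.mem_toList.2 hy)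
    refine hxn (Set.mem_iUnion.2 ⟨⟨i, ?_⟩, ?_⟩)
    · rw [Finset.length_toList] at hi
      omega
    · change dist x (X.toList.getD i 0) < 2
      rwa [List.getD_eq_getElem _ _ hi]
  have hlt : volume (Metric.ball x δ ∩ A) < β := not_le.1 fun hh => hx' ⟨hxA, hh⟩
  by_contra! hlt'
  have h1 : volume (Metric.ball x (δ / 2)) ≤
      volume (Metric.ball x δ ∩ A) + volume (Metric.ball x δ ∩ Aᶜ) := by
    refine (measure_mono ?_).trans (measure_union_le _ _)
    rw [← Set.inter_union_distrib_left, Set.union_compl_self, Set.inter_univ]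
    exact Metric.ball_subset_ball (by linarith)
  rw [Measure.addHaar_ball_center] at h1
  have h2 := h1.trans_lt (ENNReal.add_lt_add hlt hlt')
  rw [ENNReal.add_halves] at h2
  exact lt_irrefl _ h2

/-- Sets of bounded perimeter are totally bounded for `L¹` convergence on balls. -/
lemma exists_finite_approx {s C : ℝ} (hs : 0 < s) (hC : 0 < C) {K : Vd d → ℝ≥0∞}
    (hK : IsKernel s C K) {M : ℝ≥0∞} (hM : M ≠ ⊤) (R : ℝ) {ε : ℝ≥0∞} (hε : ε ≠ 0) :
    ∃ 𝒯 : Set (Set (Vd d)), 𝒯.Finite ∧ (∀ T ∈ 𝒯, MeasurableSet T) ∧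
      ∀ A : Set (Vd d), MeasurableSet A → nlPer K A ≤ M →
        ∃ T ∈ 𝒯, volume ((A ∆ T) ∩ Metric.ball 0 R) ≤ ε := by
  obtain ⟨δ, hδ, -, h⟩ := exists_scale hs hC hK hM (ENNReal.half_pos hε).ne'
  obtain ⟨t, -, htf, htc⟩ := (isCompact_closedBall (0 : Vd d) R).finite_cover_balls
    (half_pos hδ)
  refine ⟨(fun I : Set (Vd d) => ⋃ x ∈ I, Metric.ball x (δ / 2)) '' 𝒫 t, htf.powerset.image _,
    ?_, fun A hA hAM => ?_⟩
  · rintro _ ⟨I, hI, rfl⟩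
    exact (isOpen_biUnion fun _ _ => Metric.isOpen_ball).measurableSet
  set β := volume (Metric.ball (0 : Vd d) (δ / 2)) / 2 with hβ
  set I := {x ∈ t | β ≤ volume (Metric.ball x (δ / 2) ∩ A)}
  refine ⟨_, ⟨I, fun x hx => hx.1, rfl⟩, ?_⟩
  have h1 := h δ hδ le_rfl A hA hAM
  have h2 := h δ hδ le_rfl Aᶜ hA.compl (by rwa [nlPer_compl hK.1])
  refine le_trans ((measure_mono ?_).trans (measure_union_le _ _))
    ((add_le_add h1 h2).trans_eq (ENNReal.add_halves ε))
  have hsub : ∀ x y : Vd d, x ∈ Metric.ball y (δ / 2) →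
      Metric.ball y (δ / 2) ⊆ Metric.ball x δ := by
    intro x y hxy
    refine Metric.ball_subset_ball' ?_
    rw [Metric.mem_ball, dist_comm] at hxy
    linarith
  rintro x ⟨hx | hx, hxR⟩
  · refine Or.inl ⟨hx.1, ?_⟩
    obtain ⟨y, hy, hxy⟩ := Set.mem_iUnion₂.1 (htc (Metric.ball_subset_closedBall hxR))
    have hyI : ¬ β ≤ volume (Metric.ball y (δ / 2) ∩ A) := fun hh =>
      hx.2 (Set.mem_iUnion₂.2 ⟨y, ⟨hy, hh⟩, hxy⟩)
    rw [not_le] at hyI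
    by_contra! hlt'
    have h1 : volume (Metric.ball y (δ / 2)) ≤
        volume (Metric.ball y (δ / 2) ∩ A) + volume (Metric.ball x δ ∩ Aᶜ) := by
      refine (measure_mono ?_).trans (measure_union_le _ _)
      intro z hz
      by_cases hzA : z ∈ A
      · exact Or.inl ⟨hz, hzA⟩
      · exact Or.inr ⟨hsub x y hxy hz, hzA⟩
    rw [Measure.addHaar_ball_center] at h1
    have h2 := h1.trans_lt (ENNReal.add_lt_add hyI hlt')
    rw [ENNReal.add_halves] at h2
    exact lt_irrefl _ h2
  · refine Or.inr ⟨hx.2, ?_⟩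
    obtain ⟨y, hy, hxy⟩ := Set.mem_iUnion₂.1 hx.1
    rw [compl_compl]
    exact hy.2.trans (measure_mono (Set.inter_subset_inter_left _ (hsub x y hxy)))

/-- `L¹` convergence on balls of a sequence of sets, along a filter. -/
def LocLim (l : Filter ℕ) (A : ℕ → Set (Vd d)) (F : Set (Vd d)) : Prop :=
  ∀ R : ℝ, Tendsto (fun n => volume ((A n ∆ F) ∩ Metric.ball 0 R)) l (𝓝 0)

lemma exists_locLim {s C : ℝ} (hs : 0 < s) (hC : 0 < C) {K : Vd d → ℝ≥0∞}
    (hK : IsKernel s C K) {M : ℝ≥0∞} (hM : M ≠ ⊤) (𝒰 : Ultrafilter ℕ)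
    {A : ℕ → Set (Vd d)} (hA : ∀ n, MeasurableSet (A n)) (hAM : ∀ n, nlPer K (A n) ≤ M) :
    ∃ F, MeasurableSet F ∧ LocLim 𝒰 A F := by
  have hT : ∀ k : ℕ, ∃ T : Set (Vd d), MeasurableSet T ∧
      ∀ᶠ n in 𝒰, volume ((A n ∆ T) ∩ Metric.ball 0 k) ≤ (2⁻¹ : ℝ≥0∞) ^ k := by
    intro k
    obtain ⟨𝒯, hfin, hmeas, happ⟩ := exists_finite_approx hs hC hK hM k
      (ε := (2⁻¹ : ℝ≥0∞) ^ k) (pow_ne_zero _ (by simp))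
    have := (Ultrafilter.eventually_exists_mem_iff (f := 𝒰) hfin
      (P := fun T n => volume ((A n ∆ T) ∩ Metric.ball 0 k) ≤ (2⁻¹ : ℝ≥0∞) ^ k)).1
      (Eventually.of_forall fun n => happ (A n) (hA n) (hAM n))
    obtain ⟨T, hT, h⟩ := this
    exact ⟨T, hmeas T hT, h⟩
  choose T hTm hTA using hT
  set F : Set (Vd d) := ⋃ k, ⋂ j, T (k + j) with hF
  have hstep : ∀ k, volume ((T k ∆ T (k + 1)) ∩ Metric.ball 0 k) ≤ 2 * (2⁻¹ : ℝ≥0∞) ^ k := by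
    intro k
    obtain ⟨n, h1, h2⟩ := ((hTA k).and (hTA (k + 1))).exists
    have hsub : (T k ∆ T (k + 1)) ∩ Metric.ball 0 k ⊆ ((A n ∆ T k) ∩ Metric.ball 0 k) ∪
        ((A n ∆ T (k + 1)) ∩ Metric.ball 0 (k + 1 : ℕ)) := by
      rintro x ⟨hx, hxk⟩
      have hxk' : x ∈ Metric.ball (0 : Vd d) (k + 1 : ℕ) :=
        Metric.ball_subset_ball (by push_cast; linarith) hxk
      simp only [Set.mem_symmDiff, Set.mem_union, Set.mem_inter_iff] at *
      tauto
    refine (measure_mono hsub).trans ((measure_union_le _ _).trans ((add_le_add h1 h2).trans ?_))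
    rw [two_mul]
    gcongr 1 with x
    exact pow_le_pow_of_le_one zero_le (by simp) (Nat.le_succ k)
  have hTF : ∀ k, volume ((T k ∆ F) ∩ Metric.ball 0 k) ≤ 4 * (2⁻¹ : ℝ≥0∞) ^ k := by
    intro k
    have hsub : (T k ∆ F) ∩ Metric.ball 0 k ⊆
        ⋃ j, (T (k + j) ∆ T (k + j + 1)) ∩ Metric.ball 0 (k + j : ℕ) := by
      rintro x ⟨hx, hxk⟩
      by_contra hcon
      have hconst : ∀ j, x ∈ T (k + j) ↔ x ∈ T k := by
        intro j
        induction j with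
        | zero => rfl
        | succ j ih =>
          rw [← ih, ← add_assoc]
          have h1 : x ∉ (T (k + j) ∆ T (k + j + 1)) := fun h => hcon (Set.mem_iUnion.2
            ⟨j, h, Metric.ball_subset_ball
              (by push_cast; linarith [Nat.cast_nonneg (α := ℝ) j]) hxk⟩)
          rw [Set.mem_symmDiff] at h1
          tauto
      have hFk : x ∈ F ↔ x ∈ T k := by
        constructor
        · intro h
          obtain ⟨m, hm⟩ := Set.mem_iUnion.1 h
          have := Set.mem_iInter.1 hm k
          rw [add_comm] at this
          exact (hconst m).1 this
        · intro h
          exact Set.mem_iUnion.2 ⟨k, Set.mem_iInter.2 fun j => (hconst j).2 h⟩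
      rw [Set.mem_symmDiff] at hx
      tauto
    calc volume ((T k ∆ F) ∩ Metric.ball 0 k)
        ≤ ∑' j, volume ((T (k + j) ∆ T (k + j + 1)) ∩ Metric.ball 0 (k + j : ℕ)) :=
          (measure_mono hsub).trans (measure_iUnion_le _)
      _ ≤ ∑' j, 2 * (2⁻¹ : ℝ≥0∞) ^ (k + j) := ENNReal.tsum_le_tsum fun j => hstep (k + j)
      _ = 4 * (2⁻¹ : ℝ≥0∞) ^ k := by
          simp_rw [pow_add, ← mul_assoc]
          rw [ENNReal.tsum_mul_left, ENNReal.tsum_geometric, ENNReal.one_sub_inv_two, inv_inv]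
          ring
  refine ⟨F, MeasurableSet.iUnion fun k => MeasurableSet.iInter fun j => hTm _, fun R => ?_⟩
  rw [ENNReal.tendsto_nhds_zero]
  intro η hη
  have hlim : Tendsto (fun k : ℕ => 5 * (2⁻¹ : ℝ≥0∞) ^ k) atTop (𝓝 (5 * 0)) :=
    ENNReal.Tendsto.const_mul (ENNReal.tendsto_pow_atTop_nhds_zero_of_lt_one
      (ENNReal.inv_lt_one.2 ENNReal.one_lt_two)) (Or.inr (by simp))
  rw [mul_zero] at hlim
  obtain ⟨k, hk, hkR⟩ := ((hlim.eventually (Iic_mem_nhds hη)).and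
    (tendsto_natCast_atTop_atTop.eventually (eventually_ge_atTop R))).exists
  filter_upwards [hTA k] with n hn
  have hsub : (A n ∆ F) ∩ Metric.ball 0 R ⊆ ((A n ∆ T k) ∩ Metric.ball 0 k) ∪
      ((T k ∆ F) ∩ Metric.ball 0 k) := by
    rintro x ⟨hx, hxR⟩
    have hxk : x ∈ Metric.ball (0 : Vd d) k := Metric.ball_subset_ball hkR hxR
    simp only [Set.mem_symmDiff, Set.mem_union, Set.mem_inter_iff] at *
    tauto
  refine (measure_mono hsub).trans ((measure_union_le _ _).trans
    ((add_le_add hn (hTF k)).trans (le_trans (le_of_eq ?_) hk)))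
  ring

lemma measure_eq_zero_of_inter_ball {S : Set (Vd d)}
    (h : ∀ R : ℝ, volume (S ∩ Metric.ball 0 R) = 0) : volume S = 0 := by
  rw [← Set.inter_univ S, ← Metric.iUnion_ball_nat (0 : Vd d), Set.inter_iUnion]
  exact measure_iUnion_null fun n => h n

lemma LocLim.measure_inter_eq_zero {l : Filter ℕ} [l.NeBot] {A B : ℕ → Set (Vd d)}
    {F F' : Set (Vd d)} (hA : LocLim l A F) (hB : LocLim l B F')
    (h : ∀ᶠ n in l, volume (A n ∩ B n) = 0) : volume (F ∩ F') = 0 := by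
  refine measure_eq_zero_of_inter_ball fun R => ?_
  have hlim := (hA R).add (hB R)
  rw [add_zero] at hlim
  refine le_antisymm (ge_of_tendsto hlim ?_) zero_le
  filter_upwards [h] with n hn
  have hsub : F ∩ F' ∩ Metric.ball 0 R ⊆ (A n ∩ B n) ∪
      (((A n ∆ F) ∩ Metric.ball 0 R) ∪ ((B n ∆ F') ∩ Metric.ball 0 R)) := by
    intro x hx
    simp only [Set.mem_symmDiff, Set.mem_union, Set.mem_inter_iff] at *
    tauto
  refine (measure_mono hsub).trans ((measure_union_le _ _).trans ?_)
  rw [hn, zero_add]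
  exact measure_union_le _ _

lemma LocLim.iUnion {l : Filter ℕ} {ι : Type*} [Fintype ι] {A : ι → ℕ → Set (Vd d)}
    {F : ι → Set (Vd d)} (h : ∀ i, LocLim l (A i) (F i)) {D : ℕ → Set (Vd d)}
    (hD : ∀ n, D n =ᵐ[volume] ⋃ i, A i n) : LocLim l D (⋃ i, F i) := by
  intro R
  have hlim := tendsto_finsetSum Finset.univ fun i _ => h i R
  rw [Finset.sum_const_zero] at hlim
  refine tendsto_of_tendsto_of_tendsto_of_le_of_le tendsto_const_nhds hlim (fun _ => zero_le)
    fun n => ?_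
  have hcongr : (((D n ∆ ⋃ i, F i) ∩ Metric.ball 0 R : Set (Vd d))) =ᵐ[volume]
      (((⋃ i, A i n) ∆ ⋃ i, F i) ∩ Metric.ball 0 R : Set (Vd d)) :=
    ae_eq_set_inter (ae_eq_set_symmDiff (hD n) (ae_eq_refl _)) (ae_eq_refl _)
  change volume ((D n ∆ ⋃ i, F i) ∩ Metric.ball 0 R) ≤ _
  rw [measure_congr hcongr]
  have hsub : ((⋃ i, A i n) ∆ ⋃ i, F i) ∩ Metric.ball 0 R ⊆
      ⋃ i, (A i n ∆ F i) ∩ Metric.ball 0 R := by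
    rintro x ⟨hx, hxR⟩
    simp only [Set.mem_symmDiff, Set.mem_iUnion, Set.mem_inter_iff, not_exists] at *
    rcases hx with ⟨⟨i, hi⟩, hx⟩ | ⟨⟨i, hi⟩, hx⟩
    · exact ⟨i, Or.inl ⟨hi, hx i⟩, hxR⟩
    · exact ⟨i, Or.inr ⟨hi, hx i⟩, hxR⟩
  exact (measure_mono hsub).trans (measure_iUnion_fintype_le _ _)

lemma LocLim.translate {l : Filter ℕ} {A : ℕ → Set (Vd d)} {F : Set (Vd d)}
    (hA : LocLim l A F) (hF : MeasurableSet F) {h : ℕ → Vd d} {h₀ : Vd d}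
    (hh : Tendsto h l (𝓝 h₀)) :
    LocLim l (fun n => (· + h n) ⁻¹' A n) ((· + h₀) ⁻¹' F) := by
  intro R
  set B : Set (Vd d) := Metric.ball 0 (R + ‖h₀‖ + 1)
  set τ : C(Vd d, C(Vd d, Vd d)) := ContinuousMap.curry ⟨fun p => p.2 + p.1, by fun_prop⟩
  have h1 := tendsto_measure_symmDiff_preimage_nhds_zero (μ := volume) (ν := volume)
    (f := fun n => τ (h n)) (g := τ h₀) (s := F ∩ B) ((τ.continuous.tendsto h₀).comp hh)
    (Eventually.of_forall fun n => measurePreserving_add_right volume (h n))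
    (measurePreserving_add_right volume h₀)
    (hF.inter Metric.isOpen_ball.measurableSet).nullMeasurableSet
    (measure_ne_top_of_subset Set.inter_subset_right measure_ball_lt_top.ne)
  have h2 := (hA (R + ‖h₀‖ + 1)).add h1
  rw [add_zero] at h2
  refine tendsto_of_tendsto_of_tendsto_of_le_of_le' tendsto_const_nhds h2
    (Eventually.of_forall fun _ => zero_le) ?_
  have hnorm : ∀ᶠ n in l, ‖h n‖ < ‖h₀‖ + 1 :=
    hh.norm.eventually (gt_mem_nhds (by linarith))
  filter_upwards [hnorm] with n hn
  have hsub : (((· + h n) ⁻¹' A n) ∆ ((· + h₀) ⁻¹' F)) ∩ Metric.ball 0 R ⊆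
      ((· + h n) ⁻¹' ((A n ∆ F) ∩ B)) ∪ ((τ (h n) ⁻¹' (F ∩ B)) ∆ (τ h₀ ⁻¹' (F ∩ B))) := by
    rintro x ⟨hx, hxR⟩
    rw [mem_ball_zero_iff] at hxR
    have e1 : x + h n ∈ B := by
      rw [mem_ball_zero_iff]
      linarith [norm_add_le x (h n)]
    have e2 : x + h₀ ∈ B := by
      rw [mem_ball_zero_iff]
      linarith [norm_add_le x h₀]
    have e3 : τ (h n) x = x + h n := rfl
    have e4 : τ h₀ x = x + h₀ := rfl
    simp only [Set.mem_symmDiff, Set.mem_union, Set.mem_inter_iff, Set.mem_preimage, e3, e4] at *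
    tauto
  refine (measure_mono hsub).trans ((measure_union_le _ _).trans ?_)
  rw [measure_preimage_add_right]

/-- The lattice generated by a basis, as an additive subgroup. -/
def zLat (B : Module.Basis (Fin d) ℝ (Vd d)) : AddSubgroup (Vd d) :=
  (Submodule.span ℤ (Set.range B)).toAddSubgroup

instance (B : Module.Basis (Fin d) ℝ (Vd d)) : Countable (zLat B) :=
  inferInstanceAs (Countable (Submodule.span ℤ (Set.range B)))

lemma zLat_isAddFundamentalDomain (B : Module.Basis (Fin d) ℝ (Vd d)) :
    IsAddFundamentalDomain (zLat B) (ZSpan.fundamentalDomain B) volume :=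
  ZSpan.isAddFundamentalDomain' B volume

lemma coe_zLat (B : Module.Basis (Fin d) ℝ (Vd d)) : (zLat B : Set (Vd d)) = latticeOf B := by
  ext x
  change x ∈ Submodule.span ℤ (Set.range B) ↔ _
  rw [Submodule.mem_span_range_iff_exists_fun]
  simp only [latticeOf, Set.mem_ofPred_eq, Int.cast_smul_eq_zsmul, eq_comm]

lemma basis_mem_zLat (B : Module.Basis (Fin d) ℝ (Vd d)) (i : Fin d) : B i ∈ zLat B :=
  Submodule.subset_span (Set.mem_range_self i)

lemma volume_zSpan_fundamentalDomain (B : Module.Basis (Fin d) ℝ (Vd d)) :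
    volume (ZSpan.fundamentalDomain B) =
      ENNReal.ofReal |Matrix.det (Matrix.of fun i j => B j i)| := by
  rw [ZSpan.measure_fundamentalDomain B volume (EuclideanSpace.basisFun (Fin d) ℝ).toBasis,
    measure_congr (ZSpan.fundamentalDomain_ae_parallelepiped _ volume),
    OrthonormalBasis.coe_toBasis, OrthonormalBasis.volume_parallelepiped, mul_one,
    Module.Basis.det_apply]
  rfl

lemma exists_basis_of_linearIndependent {b : Fin d → Vd d} (hb : LinearIndependent ℝ b) :
    ∃ B : Module.Basis (Fin d) ℝ (Vd d), ⇑B = b := by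
  rcases isEmpty_or_nonempty (Fin d) with h | h
  · refine ⟨Module.Basis.mk hb ?_, by simp⟩
    have : d = 0 := by rw [← Fintype.card_fin d, Fintype.card_eq_zero_iff.2 h]
    subst this
    intro x _
    rw [Subsingleton.elim x 0]
    exact zero_mem _
  · exact ⟨basisOfLinearIndependentOfCardEqFinrank hb (by simp), by simp⟩

lemma IsLatticeWithVol.exists_basis {G : Set (Vd d)} {V : ℝ} (h : IsLatticeWithVol G V) :
    ∃ B : Module.Basis (Fin d) ℝ (Vd d), G = zLat B ∧
      volume (ZSpan.fundamentalDomain B) = ENNReal.ofReal V := by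
  obtain ⟨b, hb, hG, hdet⟩ := h
  obtain ⟨B, rfl⟩ := exists_basis_of_linearIndependent hb
  exact ⟨B, by rw [coe_zLat, hG], by rw [volume_zSpan_fundamentalDomain, hdet]⟩

lemma isLatticeWithVol_zLat {V : ℝ} (hV : 0 ≤ V) (B : Module.Basis (Fin d) ℝ (Vd d))
    (hB : volume (ZSpan.fundamentalDomain B) = ENNReal.ofReal V) :
    IsLatticeWithVol (zLat B : Set (Vd d)) V := by
  refine ⟨B, B.linearIndependent, coe_zLat B, ?_⟩
  rw [volume_zSpan_fundamentalDomain] at hB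
  exact (ENNReal.ofReal_eq_ofReal_iff (abs_nonneg _) hV).1 hB

lemma setTranslate_eq_preimage (g : Vd d) (A : Set (Vd d)) :
    setTranslate g A = (· + -g) ⁻¹' A := by
  rw [setTranslate, Set.image_add_right]

open scoped Pointwise in
lemma vadd_zLat_eq_setTranslate {B : Module.Basis (Fin d) ℝ (Vd d)} (g : zLat B)
    (A : Set (Vd d)) : g +ᵥ A = setTranslate (g : Vd d) A := by
  ext x
  simp only [setTranslate, Set.mem_image, Set.mem_vadd_set, AddSubgroup.vadd_def, vadd_eq_add,
    add_comm]

lemma IsFundDom.isAddFundamentalDomain {B : Module.Basis (Fin d) ℝ (Vd d)} {D : Set (Vd d)}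
    (h : IsFundDom (zLat B : Set (Vd d)) D) : IsAddFundamentalDomain (zLat B) D volume := by
  obtain ⟨hm, hdis, hcov⟩ := h
  refine IsAddFundamentalDomain.mk'' hm.nullMeasurableSet ?_ ?_ ?_
  · rw [ae_iff]
    refine measure_mono_null ?_ hcov
    intro x hx
    refine ⟨trivial, fun hx' => hx ?_⟩
    simp only [setTranslate_eq_preimage, Set.mem_iUnion, Set.mem_preimage] at hx'
    obtain ⟨g, hg, hx'⟩ := hx'
    refine ⟨⟨-g, neg_mem hg⟩, ?_⟩
    rw [add_comm] at hx'
    exact hx'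
  · intro g hg
    have := hdis g g.2 (by simpa using hg)
    rwa [AEDisjoint, vadd_zLat_eq_setTranslate]
  · intro g
    exact (measurePreserving_vadd g volume).quasiMeasurePreserving

open scoped Pointwise in
lemma isFundDom_of_zSpan (B : Module.Basis (Fin d) ℝ (Vd d)) :
    IsFundDom (zLat B : Set (Vd d)) (ZSpan.fundamentalDomain B) := by
  have h := zLat_isAddFundamentalDomain B
  refine ⟨ZSpan.fundamentalDomain_measurableSet B, ?_, ?_⟩
  · intro g hg hg0
    have := h.aedisjoint (show (⟨g, hg⟩ : zLat B) ≠ 0 by simpa [Subtype.ext_iff] using hg0)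
    rw [Function.onFun, AEDisjoint, zero_vadd (zLat B) (ZSpan.fundamentalDomain B),
      vadd_zLat_eq_setTranslate] at this
    exact this
  · have := h.ae_covers
    rw [ae_iff] at this
    refine measure_mono_null ?_ this
    rintro x ⟨-, hx⟩ ⟨g, hg⟩
    refine hx (Set.mem_iUnion₂.2 ⟨-g, neg_mem g.2, ?_⟩)
    rw [setTranslate_eq_preimage, neg_neg, Set.mem_preimage, add_comm]
    exact hg

/-- A lattice of bounded covolume and bounded packing radius has short vectors that are not
orthogonal to any prescribed direction. -/
lemma exists_short_vector {r : ℝ} (hr : 0 < r) {V : ℝ≥0∞} (hV : V ≠ ⊤) :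
    ∃ ρ : ℝ, ∀ B : Module.Basis (Fin d) ℝ (Vd d), volume (ZSpan.fundamentalDomain B) ≤ V →
      (∀ g ∈ zLat B, g ≠ 0 → r ≤ ‖g‖) → ∀ u : Vd d, ‖u‖ = 1 →
      ∃ g ∈ zLat B, ‖g‖ ≤ ρ ∧ inner ℝ u g ≠ 0 := by
  obtain ⟨m, hm⟩ : ∃ m : ℕ, V < m * volume (Metric.ball (0 : Vd d) (r / 4)) := by
    have h0 : volume (Metric.ball (0 : Vd d) (r / 4)) ≠ 0 :=
      (Metric.measure_ball_pos _ _ (by positivity)).ne'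
    obtain ⟨m, hm⟩ := ENNReal.exists_nat_mul_gt h0 hV
    exact ⟨m, hm⟩
  refine ⟨(m + 1) * r, fun B hB hmin u hu => ?_⟩
  set S : Set (Vd d) := ⋃ j : Fin m, Metric.ball (((j : ℝ) * r) • u) (r / 4)
  have hS : volume S = m * volume (Metric.ball (0 : Vd d) (r / 4)) := by
    rw [measure_iUnion]
    · simp [Measure.addHaar_ball_center]
    · intro i j hij
      refine Metric.ball_disjoint_ball ?_
      rw [dist_eq_norm, ← sub_smul, norm_smul, hu, mul_one, ← sub_mul, norm_mul,
        Real.norm_of_nonneg hr.le]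
      have : (1 : ℝ) ≤ ‖(i : ℝ) - j‖ := by
        rw [Real.norm_eq_abs]
        have : (i : ℤ) - j ≠ 0 := by
          intro h
          exact hij (Fin.ext (by omega))
        exact_mod_cast Int.one_le_abs this
      nlinarith
    · exact fun _ => Metric.isOpen_ball.measurableSet
  obtain ⟨x, y, hxy, hnd⟩ := exists_pair_mem_lattice_not_disjoint_vadd
    (zLat_isAddFundamentalDomain B)
    (MeasurableSet.iUnion fun _ => Metric.isOpen_ball.measurableSet).nullMeasurableSet
    ((hB.trans_lt hm).trans_eq hS.symm)
  obtain ⟨z, hzx, hzy⟩ := Set.not_disjoint_iff.1 hnd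
  obtain ⟨a, ha, hax⟩ := hzx
  obtain ⟨c, hc, hcy⟩ := hzy
  obtain ⟨i, hi⟩ := Set.mem_iUnion.1 ha
  obtain ⟨j, hj⟩ := Set.mem_iUnion.1 hc
  rw [mem_ball_iff_norm] at hi hj
  set g : Vd d := x - y with hg
  have hgne : g ≠ 0 := by
    rw [hg, sub_ne_zero]
    exact fun h => hxy (Subtype.ext h)
  have hgmem : g ∈ zLat B := sub_mem x.2 y.2
  have hgr := hmin g hgmem hgne
  have hsum : (x : Vd d) + a = y + c := hax.trans hcy.symm
  set e : Vd d := (c - ((j : ℝ) * r) • u) - (a - ((i : ℝ) * r) • u) with he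
  have hen : ‖e‖ < r / 2 := by
    have := norm_sub_le (c - ((j : ℝ) * r) • u) (a - ((i : ℝ) * r) • u)
    rw [← he] at this
    linarith
  have hge : g = (((j : ℝ) - i) * r) • u + e := by
    have : g = c - a := by
      rw [hg, sub_eq_sub_iff_add_eq_add, hsum, add_comm]
    rw [this, he, sub_mul, sub_smul]
    abel
  have hij : (1 : ℝ) ≤ |(j : ℝ) - i| := by
    have : (j : ℤ) - i ≠ 0 := by
      intro h
      have h' : (j : ℝ) - i = 0 := by exact_mod_cast h
      rw [hge, h', zero_mul, zero_smul, zero_add] at hgr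
      linarith
    exact_mod_cast Int.one_le_abs this
  refine ⟨g, hgmem, ?_, ?_⟩
  · have h1 : |(j : ℝ) - i| ≤ m := by
      have h1 : ((i : ℕ) : ℝ) ≤ m := by exact_mod_cast i.2.le
      have h2 : ((j : ℕ) : ℝ) ≤ m := by exact_mod_cast j.2.le
      rw [abs_le]
      constructor <;> linarith [Nat.cast_nonneg (α := ℝ) (i : ℕ), Nat.cast_nonneg (α := ℝ) (j : ℕ)]
    have h2 := norm_add_le ((((j : ℝ) - i) * r) • u) e
    rw [← hge, norm_smul, hu, mul_one, norm_mul, Real.norm_eq_abs, Real.norm_of_nonneg hr.le] at h2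
    nlinarith
  · intro h0
    have h1 := abs_real_inner_le_norm u e
    rw [hge, inner_add_right, inner_smul_right, real_inner_self_eq_norm_sq, hu] at h0
    have h2 : inner ℝ u e = -(((j : ℝ) - i) * r) := by linarith
    rw [h2, abs_neg, abs_mul, abs_of_pos hr, hu, one_mul] at h1
    nlinarith

/-- Lattices of bounded covolume and packing radius bounded below have bounded covering radius. -/
lemma exists_covering_radius {r : ℝ} (hr : 0 < r) {V : ℝ≥0∞} (hV : V ≠ ⊤) :
    ∃ R : ℝ, ∀ B : Module.Basis (Fin d) ℝ (Vd d), volume (ZSpan.fundamentalDomain B) ≤ V →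
      (∀ g ∈ zLat B, g ≠ 0 → r ≤ ‖g‖) → ∀ x : Vd d, ∃ g ∈ zLat B, ‖x - g‖ ≤ R := by
  obtain ⟨ρ, hρ⟩ := exists_short_vector (d := d) hr hV
  refine ⟨d * ρ, fun B hB hmin x => ?_⟩
  set S : Set (Vd d) := {g | g ∈ zLat B ∧ ‖g‖ ≤ ρ}
  have hspan : Submodule.span ℝ S = ⊤ := by
    by_contra hne
    have hne' : (Submodule.span ℝ S)ᗮ ≠ ⊥ := by
      rwa [Ne, Submodule.orthogonal_eq_bot_iff]
    obtain ⟨w, hw, hw0⟩ := Submodule.exists_mem_ne_zero_of_ne_bot hne'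
    obtain ⟨g, hg, hgρ, hg0⟩ := hρ B hB hmin ((‖w‖⁻¹ : ℝ) • w) (norm_smul_inv_norm (𝕜 := ℝ) hw0)
    rw [inner_smul_left] at hg0
    exact hg0 (by rw [Submodule.inner_left_of_mem_orthogonal (Submodule.subset_span
      (show g ∈ S from ⟨hg, hgρ⟩)) hw,
      mul_zero])
  set c := Module.Basis.ofSpan hspan.ge
  have hcS : ∀ i, c i ∈ S := fun i => Module.Basis.ofSpan_subset hspan.ge (Set.mem_range_self i)
  have : Fintype (LinearIndepOn.extend (linearIndepOn_empty ℝ id) (Set.empty_subset S)) :=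
    FiniteDimensional.fintypeBasisIndex c
  refine ⟨ZSpan.floor c x, ?_, ?_⟩
  · have hle : Submodule.span ℤ (Set.range c) ≤ Submodule.span ℤ (Set.range B) := by
      rw [Submodule.span_le]
      rintro _ ⟨i, rfl⟩
      exact (hcS i).1
    exact hle (ZSpan.floor c x).2
  · refine (ZSpan.norm_fract_le c x).trans ((Finset.sum_le_sum fun i _ => (hcS i).2).trans ?_)
    rw [Finset.sum_const, nsmul_eq_mul, Finset.card_univ, ← Module.finrank_eq_card_basis c]
    simp

lemma exists_tendsto_of_eventually_norm_le {E : Type*} [SeminormedAddCommGroup E] [ProperSpace E]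
    (𝒰 : Ultrafilter ℕ) {x : ℕ → E} {R : ℝ} (h : ∀ᶠ n in 𝒰, ‖x n‖ ≤ R) :
    ∃ y, Tendsto x 𝒰 (𝓝 y) := by
  obtain ⟨y, -, hy⟩ := (isCompact_closedBall (0 : E) R).ultrafilter_le_nhds (𝒰.map x)
    (by
      rw [Ultrafilter.coe_map, le_principal_iff, mem_map]
      filter_upwards [h] with n hn
      simpa using hn)
  exact ⟨y, hy⟩

/-- The limit, along an ultrafilter, of a sequence of additive subgroups. -/
def limSubgroup (𝒰 : Ultrafilter ℕ) (Λ : ℕ → AddSubgroup (Vd d)) : AddSubgroup (Vd d) where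
  carrier := {x | ∃ g : ℕ → Vd d, (∀ n, g n ∈ Λ n) ∧ Tendsto g 𝒰 (𝓝 x)}
  add_mem' := by
    rintro x y ⟨g, hg, hgx⟩ ⟨h, hh, hhy⟩
    exact ⟨fun n => g n + h n, fun n => add_mem (hg n) (hh n), hgx.add hhy⟩
  zero_mem' := ⟨fun _ => 0, fun n => zero_mem _, tendsto_const_nhds⟩
  neg_mem' := by
    rintro x ⟨g, hg, hgx⟩
    exact ⟨fun n => -g n, fun n => neg_mem (hg n), hgx.neg⟩

lemma mem_limSubgroup {𝒰 : Ultrafilter ℕ} {Λ : ℕ → AddSubgroup (Vd d)} {x : Vd d} :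
    x ∈ limSubgroup 𝒰 Λ ↔ ∃ g : ℕ → Vd d, (∀ n, g n ∈ Λ n) ∧ Tendsto g 𝒰 (𝓝 x) :=
  Iff.rfl

lemma mem_limSubgroup_of_eventually {𝒰 : Ultrafilter ℕ} {Λ : ℕ → AddSubgroup (Vd d)} {x : Vd d}
    {g : ℕ → Vd d} (hg : ∀ᶠ n in 𝒰, g n ∈ Λ n) (hx : Tendsto g 𝒰 (𝓝 x)) :
    x ∈ limSubgroup 𝒰 Λ := by
  classical
  refine ⟨fun n => if g n ∈ Λ n then g n else 0, fun n => ?_, hx.congr' ?_⟩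
  · dsimp only
    split_ifs with h
    exacts [h, zero_mem _]
  · filter_upwards [hg] with n hn
    rw [if_pos hn]

lemma le_norm_of_mem_limSubgroup {𝒰 : Ultrafilter ℕ} {Λ : ℕ → AddSubgroup (Vd d)} {r : ℝ}
    (hmin : ∀ n, ∀ g ∈ Λ n, g ≠ 0 → r ≤ ‖g‖) {x : Vd d} (hx : x ∈ limSubgroup 𝒰 Λ)
    (hx0 : x ≠ 0) : r ≤ ‖x‖ := by
  obtain ⟨g, hg, hgx⟩ := hx
  refine ge_of_tendsto hgx.norm ?_
  filter_upwards [hgx.eventually_ne hx0] with n hn using hmin n _ (hg n) hn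

lemma exists_basis_limSubgroup (𝒰 : Ultrafilter ℕ) {Λ : ℕ → AddSubgroup (Vd d)} {r R : ℝ}
    (hr : 0 < r) (hmin : ∀ n, ∀ g ∈ Λ n, g ≠ 0 → r ≤ ‖g‖)
    (hcov : ∀ n x, ∃ g ∈ Λ n, ‖x - g‖ ≤ R) :
    ∃ B : Module.Basis (Fin d) ℝ (Vd d), zLat B = limSubgroup 𝒰 Λ := by
  set L : Submodule ℤ (Vd d) := (limSubgroup 𝒰 Λ).toIntSubmodule
  have hdisc : DiscreteTopology L := by
    refine DiscreteTopology.of_forall_le_dist hr fun x y hxy => ?_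
    change r ≤ dist (x : Vd d) y
    rw [dist_eq_norm]
    refine le_norm_of_mem_limSubgroup hmin (sub_mem x.2 y.2) ?_
    rw [sub_ne_zero]
    exact fun h => hxy (Subtype.ext h)
  have hcov' : ∀ x : Vd d, ∃ g ∈ L, ‖x - g‖ ≤ R := by
    intro x
    choose g hg hgR using fun n => hcov n x
    obtain ⟨y, hy⟩ := exists_tendsto_of_eventually_norm_le 𝒰 (x := g) (R := ‖x‖ + R)
      (Eventually.of_forall fun n => by
        have := norm_sub_le x (x - g n)
        rw [sub_sub_cancel] at this
        linarith [hgR n])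
    exact ⟨y, ⟨g, hg, hy⟩, le_of_tendsto (tendsto_const_nhds.sub hy).norm
      (Eventually.of_forall hgR)⟩
  have hR : 0 ≤ R := by
    obtain ⟨g, -, hg⟩ := hcov' 0
    exact (norm_nonneg _).trans hg
  have hspan : Submodule.span ℝ (L : Set (Vd d)) = ⊤ := by
    by_contra hne
    have hne' : (Submodule.span ℝ (L : Set (Vd d)))ᗮ ≠ ⊥ := by
      rwa [Ne, Submodule.orthogonal_eq_bot_iff]
    obtain ⟨w, hw, hw0⟩ := Submodule.exists_mem_ne_zero_of_ne_bot hne'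
    set u : Vd d := (‖w‖⁻¹ : ℝ) • w
    have hu : ‖u‖ = 1 := norm_smul_inv_norm (𝕜 := ℝ) hw0
    obtain ⟨g, hg, hgR⟩ := hcov' ((R + 1) • u)
    have hg0 : inner ℝ u g = 0 :=
      Submodule.inner_left_of_mem_orthogonal (Submodule.subset_span hg)
        (Submodule.smul_mem _ _ hw)
    have h1 := real_inner_le_norm u ((R + 1) • u - g)
    rw [inner_sub_right, inner_smul_right, hg0, real_inner_self_eq_norm_sq, hu] at h1
    linarith
  have hZ : IsZLattice ℝ L := ⟨hspan⟩
  have hrank : Module.finrank ℤ L = d := by rw [ZLattice.rank ℝ L]; simp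
  have : Module.Finite ℤ L := ZLattice.module_finite ℝ L
  have : Module.Free ℤ L := ZLattice.module_free ℝ L
  set b : Module.Basis (Fin d) ℤ L := Module.finBasisOfFinrankEq ℤ L hrank
  refine ⟨b.ofZLatticeBasis ℝ L, ?_⟩
  rw [zLat, Module.Basis.ofZLatticeBasis_span]
  rfl

lemma volume_fundamentalDomain_eq_of_zLat_eq {B B₁ : Module.Basis (Fin d) ℝ (Vd d)}
    (h : zLat B = zLat B₁) :
    volume (ZSpan.fundamentalDomain B) = volume (ZSpan.fundamentalDomain B₁) := by
  have h1 := zLat_isAddFundamentalDomain B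
  rw [h] at h1
  exact h1.measure_eq (zLat_isAddFundamentalDomain B₁)

/-- Along an ultrafilter, lattices with uniform packing and covering radii eventually have bases
converging to any given basis of the limit lattice. -/
lemma eventually_zLat_eq_of_tendsto {𝒰 : Ultrafilter ℕ} {Λ : ℕ → AddSubgroup (Vd d)} {r : ℝ}
    (hr : 0 < r) (hmin : ∀ n, ∀ g ∈ Λ n, g ≠ 0 → r ≤ ‖g‖)
    {B : Module.Basis (Fin d) ℝ (Vd d)} (hB : zLat B = limSubgroup 𝒰 Λ)
    {c : ℕ → Fin d → Vd d} (hc : ∀ n i, c n i ∈ Λ n) (hcB : Tendsto c 𝒰 (𝓝 B)) :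
    ∀ᶠ n in 𝒰, ∃ C : Module.Basis (Fin d) ℝ (Vd d), ⇑C = c n ∧ zLat C = Λ n := by
  have hli : ∀ᶠ n in 𝒰, LinearIndependent ℝ (c n) :=
    hcB.eventually (isOpen_setOfPred_linearIndependent.mem_nhds B.linearIndependent)
  by_contra hcon
  rw [← Ultrafilter.eventually_not] at hcon
  have hτ : ∀ᶠ n in 𝒰, ∃ τ : Fin d → ℝ, (∀ i, |τ i| ≤ 1 / 2) ∧
      ∑ i, τ i • c n i ∈ Λ n ∧ ∑ i, τ i • c n i ≠ 0 := by
    filter_upwards [hli, hcon] with n hn hn'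
    obtain ⟨C, hC⟩ := exists_basis_of_linearIndependent hn
    have hle : zLat C ≤ Λ n := by
      rw [zLat, ← AddSubgroup.toIntSubmodule_toAddSubgroup (Λ n), Submodule.toAddSubgroup_le,
        Submodule.span_le]
      rintro _ ⟨i, rfl⟩
      rw [hC]
      exact hc n i
    obtain ⟨x, hxΛ, hxC⟩ : ∃ x ∈ Λ n, x ∉ zLat C := by
      by_contra! h
      exact hn' ⟨C, hC, le_antisymm hle h⟩
    refine ⟨fun i => C.repr x i - round (C.repr x i), fun i => abs_sub_round _, ?_⟩
    have hz : ∑ i, round (C.repr x i) • C i ∈ zLat C :=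
      sum_mem fun i _ => zsmul_mem (basis_mem_zLat C i) _
    have hy : ∑ i, (C.repr x i - round (C.repr x i)) • c n i =
        x - ∑ i, round (C.repr x i) • C i := by
      rw [← hC]
      simp_rw [sub_smul]
      rw [Finset.sum_sub_distrib, C.sum_repr]
      simp_rw [Int.cast_smul_eq_zsmul]
    rw [hy]
    refine ⟨sub_mem hxΛ (hle hz), fun h => hxC ?_⟩
    rw [sub_eq_zero.1 h]
    exact hz
  obtain ⟨τ, hτ⟩ := hτ.choice
  obtain ⟨t, ht⟩ := exists_tendsto_of_eventually_norm_le 𝒰 (x := τ) (R := 1 / 2) (by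
    filter_upwards [hτ] with n hn
    exact (pi_norm_le_iff_of_nonneg (by norm_num)).2 hn.1)
  have hlim : Tendsto (fun n => ∑ i, τ n i • c n i) 𝒰 (𝓝 (∑ i, t i • B i)) :=
    tendsto_finsetSum _ fun i _ => (tendsto_pi_nhds.1 ht i).smul (tendsto_pi_nhds.1 hcB i)
  have hmem : ∑ i, t i • B i ∈ zLat B := by
    rw [hB]
    exact mem_limSubgroup_of_eventually (hτ.mono fun n hn => hn.2.1) hlim
  have hrepr : ∀ i, B.repr (∑ i, t i • B i) i = t i := fun i => by rw [B.repr_sum_self]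
  have ht0 : ∀ i, t i = 0 := by
    intro i
    have h1 : |t i| ≤ 1 / 2 := le_of_tendsto (tendsto_pi_nhds.1 ht i).abs
      (hτ.mono fun n hn => hn.1 i)
    obtain ⟨k, hk⟩ := (B.mem_span_iff_repr_mem ℤ _).1 hmem i
    rw [hrepr] at hk
    rw [← hk] at h1 ⊢
    have h2 : |(k : ℝ)| ≤ 1 / 2 := h1
    have h3 : |k| < 1 := by
      have : ((|k| : ℤ) : ℝ) < 1 := by push_cast; linarith
      exact_mod_cast this
    rw [Int.abs_lt_one_iff.1 h3, map_zero]
  have hge : r ≤ ‖∑ i, t i • B i‖ := ge_of_tendsto hlim.norm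
    (hτ.mono fun n hn => hmin n _ hn.2.1 hn.2.2)
  simp only [ht0, zero_smul, Finset.sum_const_zero, norm_zero] at hge
  linarith

/-- Compactness of lattices with fixed covolume and packing radius bounded below. -/
lemma exists_limit_zLat (𝒰 : Ultrafilter ℕ) {B : ℕ → Module.Basis (Fin d) ℝ (Vd d)} {V : ℝ≥0∞}
    (hB : ∀ n, volume (ZSpan.fundamentalDomain (B n)) = V) {r R : ℝ} (hr : 0 < r)
    (hmin : ∀ n, ∀ g ∈ zLat (B n), g ≠ 0 → r ≤ ‖g‖)
    (hcov : ∀ n x, ∃ g ∈ zLat (B n), ‖x - g‖ ≤ R) :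
    ∃ B₀ : Module.Basis (Fin d) ℝ (Vd d), volume (ZSpan.fundamentalDomain B₀) = V ∧
      ∀ x ∈ zLat B₀, ∃ g : ℕ → Vd d, (∀ n, g n ∈ zLat (B n)) ∧ Tendsto g 𝒰 (𝓝 x) := by
  obtain ⟨B₀, hB₀⟩ := exists_basis_limSubgroup 𝒰 hr hmin hcov
  have hlim : ∀ x ∈ zLat B₀, ∃ g : ℕ → Vd d, (∀ n, g n ∈ zLat (B n)) ∧ Tendsto g 𝒰 (𝓝 x) :=
    fun x hx => mem_limSubgroup.1 (hB₀ ▸ hx)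
  refine ⟨B₀, ?_, hlim⟩
  choose c hc hcB using fun i => hlim (B₀ i) (basis_mem_zLat B₀ i)
  have hcB' : Tendsto (fun n i => c i n) 𝒰 (𝓝 B₀) := tendsto_pi_nhds.2 hcB
  have hev := eventually_zLat_eq_of_tendsto hr hmin hB₀ (fun n i => hc i n) hcB'
  have hdet : Tendsto (fun n => ENNReal.ofReal |Matrix.det (Matrix.of fun i j => c j n i)|) 𝒰
      (𝓝 (volume (ZSpan.fundamentalDomain B₀))) := by
    rw [volume_zSpan_fundamentalDomain]
    have hcont : Continuous fun b : Fin d → Vd d =>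
        ENNReal.ofReal |Matrix.det (Matrix.of fun i j => b j i)| := by
      refine ENNReal.continuous_ofReal.comp (continuous_abs.comp (Continuous.matrix_det ?_))
      exact continuous_matrix fun i j => by
        simp only [Matrix.of_apply]
        fun_prop
    exact (hcont.tendsto _).comp hcB'
  refine tendsto_nhds_unique hdet (tendsto_const_nhds.congr' ?_)
  filter_upwards [hev] with n ⟨C, hC, hCB⟩
  rw [← hB n, ← volume_fundamentalDomain_eq_of_zLat_eq hCB, volume_zSpan_fundamentalDomain, hC]

lemma exists_separated_subfamily {P : Type*} (𝒰 : Ultrafilter ℕ) (x : P → ℕ → Vd d) :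
    ∃ Q : Set P, (∀ p ∈ Q, ∀ q ∈ Q, p ≠ q → ∀ ρ : ℝ, ∀ᶠ n in 𝒰, ρ < dist (x p n) (x q n)) ∧
      ∀ p, ∃ q ∈ Q, ∃ ρ : ℝ, ∀ᶠ n in 𝒰, dist (x p n) (x q n) ≤ ρ := by
  let S : Setoid P :=
    { r := fun p q => ∃ ρ : ℝ, ∀ᶠ n in 𝒰, dist (x p n) (x q n) ≤ ρ
      iseqv :=
        { refl := fun p => ⟨0, Eventually.of_forall fun n => (dist_self _).le⟩
          symm := fun ⟨ρ, h⟩ => ⟨ρ, h.mono fun n hn => by rwa [dist_comm]⟩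
          trans := fun ⟨ρ, h⟩ ⟨ρ', h'⟩ => ⟨ρ + ρ', (h.and h').mono fun n hn =>
            (dist_triangle _ _ _).trans (add_le_add hn.1 hn.2)⟩ } }
  refine ⟨Set.range (Quotient.out : Quotient S → P), ?_, fun p => ?_⟩
  · rintro _ ⟨p, rfl⟩ _ ⟨q, rfl⟩ hpq ρ
    by_contra hcon
    rw [← Ultrafilter.eventually_not] at hcon
    simp only [not_lt] at hcon
    have h : S p.out q.out := ⟨ρ, hcon⟩
    exact hpq (congrArg Quotient.out (Quotient.out_equiv_out.1 h))
  · exact ⟨(⟦p⟧ : Quotient S).out, ⟨_, rfl⟩, S.symm (Quotient.mk_out p)⟩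

/-- Sets of bounded volume and perimeter concentrate, along an ultrafilter, near countably many
sequences of centers that drift apart; the centers may be taken in any prescribed relatively dense
sets. -/
lemma exists_concentration_centers {s C : ℝ} (hs : 0 < s) (hC : 0 < C) {K : Vd d → ℝ≥0∞}
    (hK : IsKernel s C K) {M : ℝ≥0∞} (hM : M ≠ ⊤) {V : ℝ≥0∞} (hV : V ≠ ⊤) (𝒰 : Ultrafilter ℕ)
    {A : ℕ → Set (Vd d)} (hA : ∀ n, MeasurableSet (A n)) (hAV : ∀ n, volume (A n) ≤ V)
    (hAM : ∀ n, nlPer K (A n) ≤ M) {Λ : ℕ → AddSubgroup (Vd d)} {R : ℝ}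
    (hcov : ∀ n x, ∃ g ∈ Λ n, ‖x - g‖ ≤ R) :
    ∃ (Q : Type) (_ : Countable Q) (g : Q → ℕ → Vd d), (∀ q n, g q n ∈ Λ n) ∧
      (∀ q q', q ≠ q' → ∀ ρ : ℝ, ∀ᶠ n in 𝒰, ρ < dist (g q n) (g q' n)) ∧
      ∀ ε : ℝ≥0∞, ε ≠ 0 → ∃ (S : Finset Q) (ρ : ℝ),
        ∀ᶠ n in 𝒰, volume (A n \ ⋃ q ∈ S, Metric.ball (g q n) ρ) ≤ ε := by
  have hball : ∀ j : ℕ, ((j : ℝ≥0∞) + 1)⁻¹ ≠ 0 := fun j => by simp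
  choose m hm using fun j => exists_ball_cover hs hC hK hM hV (hball j)
  choose x hx using fun j n => hm j (A n) (hA n) (hAV n) (hAM n)
  choose c hc hcR using hcov
  let g : (Σ j, Fin (m j)) → ℕ → Vd d := fun p n => c n (x p.1 n p.2)
  obtain ⟨Q, hQ, hcl⟩ := exists_separated_subfamily 𝒰 g
  refine ⟨Q, inferInstance, fun q => g q, fun q n => hc _ _,
    fun q q' hqq' => hQ q q.2 q' q'.2 fun h => hqq' (Subtype.ext h), fun ε hε => ?_⟩
  obtain ⟨j, hj⟩ : ∃ j : ℕ, ((j : ℝ≥0∞) + 1)⁻¹ ≤ ε := by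
    obtain ⟨j, hj⟩ := ENNReal.exists_inv_nat_lt hε
    exact ⟨j, le_trans (ENNReal.inv_le_inv.2 le_self_add) hj.le⟩
  choose q hqQ ρ hρ using fun i : Fin (m j) => hcl ⟨j, i⟩
  classical
  refine ⟨Finset.univ.image fun i => ⟨q i, hqQ i⟩, 2 + R + ∑ i, |ρ i|, ?_⟩
  have hev : ∀ᶠ n in (𝒰 : Filter ℕ), ∀ i, dist (g ⟨j, i⟩ n) (g (q i) n) ≤ ρ i :=
    eventually_all.2 hρ
  filter_upwards [hev] with n hn
  refine (measure_mono ?_).trans ((hx j n).trans hj)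
  refine Set.sdiff_subset_sdiff_right (Set.iUnion_subset fun i => ?_)
  intro y hy
  simp only [Finset.mem_image, Finset.mem_univ, true_and, Set.mem_iUnion]
  refine ⟨⟨q i, hqQ i⟩, ⟨i, rfl⟩, ?_⟩
  rw [Metric.mem_ball] at hy ⊢
  have h1 : dist (x j n i) (g ⟨j, i⟩ n) ≤ R := by
    rw [dist_eq_norm]
    exact hcR n (x j n i)
  have h2 : ρ i ≤ ∑ i, |ρ i| :=
    (le_abs_self _).trans (Finset.single_le_sum (fun i _ => abs_nonneg (ρ i)) (Finset.mem_univ i))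
  have h3 := dist_triangle4 y (x j n i) (g ⟨j, i⟩ n) (g (q i) n)
  have h4 := hn i
  change dist y (g (q i) n) < _
  linarith

/-- The profiles of a concentrating sequence carry the whole volume. -/
lemma le_tsum_volume_of_locLim {Q : Type*} {l : Filter ℕ} [l.NeBot] {A : ℕ → Set (Vd d)}
    {g : Q → ℕ → Vd d} {F : Q → Set (Vd d)}
    (hF : ∀ q, LocLim l (fun n => (· + g q n) ⁻¹' A n) (F q))
    (hconc : ∀ ε : ℝ≥0∞, ε ≠ 0 → ∃ (S : Finset Q) (ρ : ℝ),
        ∀ᶠ n in l, volume (A n \ ⋃ q ∈ S, Metric.ball (g q n) ρ) ≤ ε)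
    {w : ℝ≥0∞} (hw : Tendsto (fun n => volume (A n)) l (𝓝 w)) : w ≤ ∑' q, volume (F q) := by
  refine ENNReal.le_of_forall_pos_le_add fun ε hε _ => ?_
  obtain ⟨S, ρ, hS⟩ := hconc ε (by exact_mod_cast hε.ne')
  have hlim : Tendsto (fun n => (∑ q ∈ S, (volume (F q) +
      volume ((((· + g q n) ⁻¹' A n) ∆ F q) ∩ Metric.ball 0 ρ))) + (ε : ℝ≥0∞)) l
      (𝓝 ((∑ q ∈ S, (volume (F q) + 0)) + ε)) :=
    (tendsto_finsetSum _ fun q _ => tendsto_const_nhds.add (hF q ρ)).add tendsto_const_nhds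
  simp only [add_zero] at hlim
  have hle : w ≤ ∑ q ∈ S, volume (F q) + ε := by
    refine le_of_tendsto_of_tendsto hw hlim ?_
    filter_upwards [hS] with n hn
    have hsub : A n ⊆ (⋃ q ∈ S, A n ∩ Metric.ball (g q n) ρ) ∪
        (A n \ ⋃ q ∈ S, Metric.ball (g q n) ρ) := by
      intro y hy
      simp only [Set.mem_union, Set.mem_iUnion, Set.mem_inter_iff, Set.mem_sdiff]
      by_cases h : ∃ q, ∃ _ : q ∈ S, y ∈ Metric.ball (g q n) ρ
      · obtain ⟨q, hq, h⟩ := h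
        exact Or.inl ⟨q, hq, hy, h⟩
      · exact Or.inr ⟨hy, h⟩
    refine (measure_mono hsub).trans ((measure_union_le _ _).trans (add_le_add ?_ hn))
    refine (measure_biUnion_finset_le _ _).trans (Finset.sum_le_sum fun q _ => ?_)
    rw [← measure_preimage_add_right volume (g q n)]
    refine (measure_mono ?_).trans (measure_union_le _ _)
    rintro y ⟨hy, hyρ⟩
    have hyρ' : y ∈ Metric.ball (0 : Vd d) ρ := by
      simpa [Metric.mem_ball, dist_eq_norm] using hyρ
    simp only [Set.mem_union, Set.mem_inter_iff, Set.mem_symmDiff, Set.mem_preimage] at *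
    tauto
  exact hle.trans (add_le_add_left (ENNReal.sum_le_tsum S) _)

/-- A measurable set whose lattice translates overlap in null sets packs the space at most once. -/
lemma volume_iUnion_inter_fundamentalDomain {B : Module.Basis (Fin d) ℝ (Vd d)} {D : Set (Vd d)}
    (hD : MeasurableSet D)
    (hdisj : ∀ g ∈ zLat B, g ≠ 0 → volume (setTranslate g D ∩ D) = 0) :
    volume ((⋃ g : zLat B, setTranslate (g : Vd d) D) ∩ ZSpan.fundamentalDomain B) =
      volume D := by
  have hm : ∀ g : Vd d, MeasurableSet (setTranslate g D) := fun g => by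
    rw [setTranslate_eq_preimage]
    exact (measurable_add_const _) hD
  rw [(zLat_isAddFundamentalDomain B).measure_eq_tsum D, Set.iUnion_inter, measure_iUnion₀]
  · simp_rw [vadd_zLat_eq_setTranslate]
  · intro g h hgh
    refine measure_mono_null (Set.inter_subset_inter Set.inter_subset_left
      Set.inter_subset_left) ?_
    have h0 := hdisj (g - h) (sub_mem g.2 h.2) (sub_ne_zero.2 fun e => hgh (Subtype.ext e))
    rw [← measure_preimage_add_right volume (h : Vd d)]
    convert h0 using 3
    · simp only [setTranslate_eq_preimage]
      ext y
      simp [add_assoc, sub_eq_add_neg]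
  · exact fun g => ((hm g).inter (ZSpan.fundamentalDomain_measurableSet B)).nullMeasurableSet

open scoped Pointwise in
lemma isFundDom_of_volume_le {B : Module.Basis (Fin d) ℝ (Vd d)} {D : Set (Vd d)}
    (hD : MeasurableSet D)
    (hdisj : ∀ g ∈ zLat B, g ≠ 0 → volume (setTranslate g D ∩ D) = 0)
    (hvol : volume (ZSpan.fundamentalDomain B) ≤ volume D) :
    IsFundDom (zLat B : Set (Vd d)) D := by
  refine ⟨hD, hdisj, ?_⟩
  set U : Set (Vd d) := ⋃ g : zLat B, setTranslate (g : Vd d) D with hU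
  have hUm : MeasurableSet U := MeasurableSet.iUnion fun g => by
    rw [setTranslate_eq_preimage]
    exact (measurable_add_const _) hD
  have hfin : volume (ZSpan.fundamentalDomain B) ≠ ⊤ := by
    rw [volume_zSpan_fundamentalDomain]
    exact ENNReal.ofReal_ne_top
  have hUB : volume (Uᶜ ∩ ZSpan.fundamentalDomain B) = 0 := by
    have h1 := measure_inter_add_sdiff (μ := volume) (ZSpan.fundamentalDomain B) hUm
    rw [Set.inter_comm, volume_iUnion_inter_fundamentalDomain hD hdisj] at h1
    rw [Set.inter_comm, ← Set.sdiff_eq]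
    by_contra h0
    have h2 : volume D ≠ ⊤ := fun h => hfin (by rw [← h1, h, top_add])
    exact absurd h1 (ne_of_gt (hvol.trans_lt (ENNReal.lt_add_right h2 h0)))
  have hmem : ∀ (g : zLat B) y, y ∈ U → y + g ∈ U := by
    intro g y hy
    obtain ⟨h, z, hz, rfl⟩ := Set.mem_iUnion.1 hy
    exact Set.mem_iUnion.2 ⟨h + g, z, hz, (add_assoc _ _ _).symm⟩
  have hinv : ∀ g : zLat B, g +ᵥ Uᶜ = Uᶜ := by
    intro g
    rw [vadd_zLat_eq_setTranslate, setTranslate_eq_preimage]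
    ext y
    refine not_congr ⟨fun h => ?_, fun h => hmem (-g) y h⟩
    have := hmem g _ h
    rwa [neg_add_cancel_right] at this
  have h0 := (zLat_isAddFundamentalDomain B).measure_zero_of_invariant Uᶜ hinv hUB
  rw [← Set.compl_eq_univ_sdiff]
  convert h0 using 3
  rw [hU, Set.iUnion_subtype]
  rfl

lemma IsFundDom.volume_preimage_inter {B : Module.Basis (Fin d) ℝ (Vd d)} {D : Set (Vd d)}
    (h : IsFundDom (zLat B : Set (Vd d)) D) {a b : Vd d} (ha : a ∈ zLat B) (hb : b ∈ zLat B)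
    (hab : a ≠ b) : volume ((· + a) ⁻¹' D ∩ (· + b) ⁻¹' D) = 0 := by
  have h0 := h.2.1 (b - a) (sub_mem hb ha) (sub_ne_zero.2 hab.symm)
  rw [← measure_preimage_add_right volume b] at h0
  convert h0 using 3
  simp only [setTranslate_eq_preimage]
  ext y
  simp

lemma AdmissiblePart₀.ae_eq_iUnion {D : Set (Vd d)} {N : ℕ} {E : Fin N → Set (Vd d)}
    (h : AdmissiblePart₀ D E) : D =ᵐ[volume] ⋃ i, E i :=
  Filter.EventuallyLE.antisymm (ae_le_set.2 h.2.2.2)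
    (ae_of_all _ fun _ hx => Set.iUnion_subset h.2.1 hx)

lemma AdmissiblePart₀.sum_volume {D : Set (Vd d)} {N : ℕ} {E : Fin N → Set (Vd d)}
    (h : AdmissiblePart₀ D E) : ∑ i, volume (E i) = volume D := by
  rw [measure_congr h.ae_eq_iUnion, measure_iUnion₀ (fun i j hij => h.2.2.1 i j hij)
    fun i => (h.1 i).nullMeasurableSet, tsum_fintype]

/-- Compactness and lower semicontinuity, along an ultrafilter, for partitions of fundamental
domains with bounded nonlocal perimeter. -/
lemma exists_limit_partition {s C : ℝ} (hs : 0 < s) (hC : 0 < C) {K : Vd d → ℝ≥0∞}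
    (hK : IsKernel s C K) {M V : ℝ≥0∞} (hM : M ≠ ⊤) (hV : V ≠ ⊤) (hV0 : V ≠ 0)
    (𝒰 : Ultrafilter ℕ) {N : ℕ} {B : ℕ → Module.Basis (Fin d) ℝ (Vd d)} {D : ℕ → Set (Vd d)}
    {E : ℕ → Fin N → Set (Vd d)} (hBV : ∀ n, volume (ZSpan.fundamentalDomain (B n)) = V)
    (hD : ∀ n, IsFundDom (zLat (B n) : Set (Vd d)) (D n)) (hE : ∀ n, AdmissiblePart₀ (D n) (E n))
    (hEM : ∀ n i, nlPer K (E n i) ≤ M) (hDM : ∀ n, nlPer K (D n) ≤ M) :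
    ∃ (B₀ : Module.Basis (Fin d) ℝ (Vd d)) (D₀ : Set (Vd d)) (E₀ : Fin N → Set (Vd d)),
      volume (ZSpan.fundamentalDomain B₀) = V ∧ IsFundDom (zLat B₀ : Set (Vd d)) D₀ ∧
      AdmissiblePart₀ D₀ E₀ ∧
      (∀ i, Tendsto (fun n => volume (E n i)) 𝒰 (𝓝 (volume (E₀ i)))) ∧
      (∀ i P, (∀ᶠ n in 𝒰, nlPer K (E n i) ≤ P) → nlPer K (E₀ i) ≤ P) ∧
      ∀ P, (∀ᶠ n in 𝒰, nlPer K (D n) ≤ P) → nlPer K D₀ ≤ P := by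
  have hDV : ∀ n, volume (D n) = V := fun n => by
    rw [← hBV n]
    exact (hD n).isAddFundamentalDomain.measure_eq (zLat_isAddFundamentalDomain (B n))
  obtain ⟨r, hr, hpack⟩ := exists_packing hs hC hK hM hV hV0
  have hmin : ∀ n, ∀ g ∈ zLat (B n), g ≠ 0 → r ≤ ‖g‖ := fun n g hg hg0 =>
    hpack (D n) (hD n).1 (hDV n) (hDM n) g hg0 (by
      have := (hD n).volume_preimage_inter hg (zero_mem _) hg0
      simpa only [add_zero, Set.preimage_id'] using this)
  obtain ⟨R, hR⟩ := exists_covering_radius (d := d) hr hV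
  have hcov : ∀ n x, ∃ g ∈ zLat (B n), ‖x - g‖ ≤ R := fun n => hR (B n) (hBV n).le (hmin n)
  obtain ⟨B₀, hB₀, hlat⟩ := exists_limit_zLat 𝒰 hBV hr hmin hcov
  obtain ⟨Q, _, g, hgΛ, hsep, hconc⟩ := exists_concentration_centers hs hC hK hM hV 𝒰
    (fun n => (hD n).1) (fun n => (hDV n).le) hDM hcov
  have hF : ∀ i q, ∃ F, MeasurableSet F ∧ LocLim 𝒰 (fun n => (· + g q n) ⁻¹' E n i) F :=
    fun i q => exists_locLim hs hC hK hM 𝒰 (fun n => (measurable_add_const _) ((hE n).1 i))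
      fun n => (nlPer_translate K _ _).trans_le (hEM n i)
  choose F hFm hF using hF
  set G : Q → Set (Vd d) := fun q => ⋃ i, F i q with hG
  have hGm : ∀ q, MeasurableSet (G q) := fun q => MeasurableSet.iUnion fun i => hFm i q
  have hGlim : ∀ q, LocLim 𝒰 (fun n => (· + g q n) ⁻¹' D n) (G q) := fun q => by
    refine LocLim.iUnion (fun i => hF i q) fun n => ?_
    rw [← Set.preimage_iUnion]
    exact (measurePreserving_add_right volume (g q n)).quasiMeasurePreserving.preimage_ae_eq
      (hE n).ae_eq_iUnion
  have hGdisj : ∀ a ∈ zLat B₀, ∀ q q', (a ≠ 0 ∨ q ≠ q') →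
      volume (setTranslate a (G q) ∩ G q') = 0 := by
    intro a ha q q' hor
    obtain ⟨h, hh, hha⟩ := hlat a ha
    rw [setTranslate_eq_preimage]
    refine ((hGlim q).translate (hGm q) hha.neg).measure_inter_eq_zero (hGlim q') ?_
    have hne : ∀ᶠ n in 𝒰, -h n + g q n ≠ g q' n := by
      by_cases hq : q = q'
      · subst hq
        filter_upwards [hha.eventually_ne (hor.resolve_right fun h => h rfl)] with n hn
        simpa using hn
      · filter_upwards [hsep q q' hq (‖a‖ + 1),
          hha.norm.eventually (gt_mem_nhds (lt_add_one ‖a‖))] with n hn hn' heq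
        rw [dist_eq_norm, ← heq] at hn
        rw [sub_add_cancel_right, neg_neg] at hn
        linarith
    filter_upwards [hne] with n hn
    have := (hD n).volume_preimage_inter (add_mem (neg_mem (hh n)) (hgΛ q n)) (hgΛ q' n) hn
    simp only [← add_assoc] at this
    exact this
  have hGG : Pairwise fun q q' => volume (G q ∩ G q') = 0 := by
    intro q q' hqq'
    have := hGdisj 0 (zero_mem _) q q' (Or.inr hqq')
    simpa [setTranslate] using this
  set E₀ : Fin N → Set (Vd d) := fun i => ⋃ q, F i q with hE₀
  set D₀ : Set (Vd d) := ⋃ q, G q with hD₀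
  have hD₀E₀ : D₀ = ⋃ i, E₀ i := Set.iUnion_comm _
  have hD₀m : MeasurableSet D₀ := MeasurableSet.iUnion hGm
  have hVD₀ : V ≤ volume D₀ := by
    rw [hD₀, measure_iUnion₀ hGG fun q => (hGm q).nullMeasurableSet]
    refine le_tsum_volume_of_locLim hGlim hconc ?_
    simp only [hDV]
    exact tendsto_const_nhds
  have hfund : IsFundDom (zLat B₀ : Set (Vd d)) D₀ := by
    refine isFundDom_of_volume_le hD₀m (fun a ha ha0 => ?_) (hB₀.trans_le hVD₀)
    have : setTranslate a D₀ = ⋃ q, setTranslate a (G q) := Set.image_iUnion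
    rw [this, hD₀, Set.iUnion_inter]
    refine measure_iUnion_null fun q => ?_
    rw [Set.inter_iUnion]
    exact measure_iUnion_null fun q' => hGdisj a ha q q' (Or.inl ha0)
  have hFG : ∀ i q, F i q ⊆ G q := fun i q => Set.subset_iUnion (fun i => F i q) i
  have hadm : AdmissiblePart₀ D₀ E₀ := by
    refine ⟨fun i => MeasurableSet.iUnion (hFm i), fun i => Set.iUnion_mono fun q => hFG i q,
      fun i j hij => ?_, by rw [hD₀E₀, Set.sdiff_self, measure_empty]⟩
    simp only [hE₀]
    rw [Set.iUnion_inter]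
    refine measure_iUnion_null fun q => ?_
    rw [Set.inter_iUnion]
    refine measure_iUnion_null fun q' => ?_
    by_cases hq : q = q'
    · subst hq
      refine (hF i q).measure_inter_eq_zero (hF j q) (Eventually.of_forall fun n => ?_)
      rw [← Set.preimage_inter, measure_preimage_add_right]
      exact (hE n).2.2.1 i j hij
    · exact measure_mono_null (Set.inter_subset_inter (hFG i q) (hFG j q')) (hGG hq)
  have hD₀V : volume D₀ = V := by
    rw [← hB₀]
    exact hfund.isAddFundamentalDomain.measure_eq (zLat_isAddFundamentalDomain B₀)
  refine ⟨B₀, D₀, E₀, hB₀, hfund, hadm, ?_, fun i P hP => ?_, fun P hP => ?_⟩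
  · have hw : ∀ i, ∃ w, Tendsto (fun n => volume (E n i)) 𝒰 (𝓝 w) := fun i => by
      obtain ⟨w, -, hw⟩ := isCompact_univ.ultrafilter_le_nhds
        (𝒰.map fun n => volume (E n i)) (by simp)
      exact ⟨w, hw⟩
    choose w hw using hw
    have hwle : ∀ i, w i ≤ volume (E₀ i) := by
      intro i
      rw [hE₀, measure_iUnion₀ (fun q q' hqq' => measure_mono_null
        (Set.inter_subset_inter (hFG i q) (hFG i q')) (hGG hqq'))
        fun q => (hFm i q).nullMeasurableSet]
      refine le_tsum_volume_of_locLim (hF i) (fun ε hε => ?_) (hw i)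
      obtain ⟨S, ρ, hS⟩ := hconc ε hε
      exact ⟨S, ρ, hS.mono fun n hn =>
        (measure_mono (Set.sdiff_subset_sdiff_left ((hE n).2.1 i))).trans hn⟩
    have hwsum : ∑ i, w i = V := by
      refine tendsto_nhds_unique (tendsto_finsetSum Finset.univ fun i _ => hw i) ?_
      simp only [(hE _).sum_volume, hDV]
      exact tendsto_const_nhds
    intro i
    suffices hi : volume (E₀ i) ≤ w i by
      rw [le_antisymm hi (hwle i)]
      exact hw i
    have h1 : volume (E₀ i) + ∑ j ∈ Finset.univ.erase i, w j ≤
        w i + ∑ j ∈ Finset.univ.erase i, w j := by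
      rw [Finset.add_sum_erase _ _ (Finset.mem_univ i), hwsum, ← hD₀V, ← hadm.sum_volume,
        ← Finset.add_sum_erase _ _ (Finset.mem_univ i)]
      gcongr with j
      exact hwle j
    refine (ENNReal.add_le_add_iff_right ?_).1 h1
    refine ne_top_of_le_ne_top hV (le_trans (Finset.sum_le_sum_of_subset
      (Finset.erase_subset _ _)) hwsum.le)
  · exact (nlPer_iUnion_le K _).trans (tsum_nlPer_le_of_profiles hK.1.1 (fun n => (hE n).1 i) hsep
      (hFm i) (fun q => hF i q) hP)
  · exact (nlPer_iUnion_le K _).trans (tsum_nlPer_le_of_profiles hK.1.1 (fun n => (hD n).1) hsep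
      hGm hGlim hP)

/-- Cubic lattices: every positive scale is realised. -/
lemma exists_basis_covolume {L : ℝ} (hL : 0 < L) :
    ∃ B : Module.Basis (Fin d) ℝ (Vd d),
      volume (ZSpan.fundamentalDomain B) = ENNReal.ofReal (L ^ d) := by
  refine ⟨(EuclideanSpace.basisFun (Fin d) ℝ).toBasis.isUnitSMul (w := fun _ => L)
    fun _ => hL.ne'.isUnit, ?_⟩
  rw [volume_zSpan_fundamentalDomain]
  have : (Matrix.of fun i j => ((EuclideanSpace.basisFun (Fin d) ℝ).toBasis.isUnitSMul
      (w := fun _ => L) fun _ => hL.ne'.isUnit) j i) = Matrix.diagonal fun _ : Fin d => L := by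
    ext i j
    simp [Module.Basis.isUnitSMul_apply, Matrix.diagonal_apply]
  rw [this, Matrix.det_diagonal, Finset.prod_const, Finset.card_univ, Fintype.card_fin,
    abs_of_pos (pow_pos hL d)]

lemma admissiblePart₀_single {D : Set (Vd d)} (hD : MeasurableSet D) {N : ℕ} (k : Fin N) :
    AdmissiblePart₀ D fun i => if i = k then D else ∅ := by
  refine ⟨fun i => ?_, fun i => ?_, fun i j hij => ?_, ?_⟩
  · dsimp only
    split_ifs
    exacts [hD, MeasurableSet.empty]
  · dsimp only
    split_ifs
    exacts [subset_rfl, Set.empty_subset _]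
  · by_cases hi : i = k
    · have hj : j ≠ k := fun h => hij (hi.trans h.symm)
      simp [hj]
    · simp [hi]
  · refine measure_mono_null ?_ (measure_empty (μ := volume))
    rintro x ⟨hx, hx'⟩
    exact hx' (Set.mem_iUnion.2 ⟨k, by simpa using hx⟩)

lemma exists_tendsto_ge_of_lsc {𝒰 : Ultrafilter ℕ} {f : ℕ → ℝ≥0∞} {a : ℝ≥0∞}
    (h : ∀ P, (∀ᶠ n in 𝒰, f n ≤ P) → a ≤ P) : ∃ w, Tendsto f 𝒰 (𝓝 w) ∧ a ≤ w := by
  obtain ⟨w, -, hw⟩ := isCompact_univ.ultrafilter_le_nhds (𝒰.map f) (by simp)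
  refine ⟨w, hw, le_of_forall_gt_imp_ge_of_dense fun P hP => h P ?_⟩
  have hw' : Tendsto f 𝒰 (𝓝 w) := hw
  exact (hw'.eventually (gt_mem_nhds hP)).mono fun n hn => hn.le

lemma tendsto_ediff {l : Filter ℕ} {f : ℕ → ℝ≥0∞} {a b : ℝ≥0∞} (hf : Tendsto f l (𝓝 a))
    (hb : b ≠ ⊤) : Tendsto (fun n => ediff (f n) b) l (𝓝 (ediff a b)) :=
  (ENNReal.Tendsto.sub hf tendsto_const_nhds (Or.inr hb)).add
    (ENNReal.Tendsto.sub tendsto_const_nhds hf (Or.inl hb))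

lemma nlPer_le_sum_of_admissiblePart₀ (K : Vd d → ℝ≥0∞) {D : Set (Vd d)} {N : ℕ}
    {E : Fin N → Set (Vd d)} (h : AdmissiblePart₀ D E) : nlPer K D ≤ ∑ i, nlPer K (E i) := by
  rw [nlPer_congr_ae K h.ae_eq_iUnion]
  exact (nlPer_iUnion_le K E).trans_eq (tsum_fintype _)

theorem stmt4 {d : ℕ} (hd : 1 ≤ d) (s C : ℝ) (hs : s ∈ Set.Ioo (0:ℝ) 1) (hC : 0 < C)
    (K : Vd d → ℝ≥0∞) (hK : IsKernel s C K)
    (L μ lam : ℝ) (hL : 0 < L) (hμ : 0 ≤ μ) (hlam : 0 < lam)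
    (N : ℕ) (v : Fin N → ℝ) (hv : ∀ i, 0 < v i) (hsum : ∑ i, v i = L ^ d) :
    ∃ (G : Set (Vd d)) (D : Set (Vd d)) (E : Fin N → Set (Vd d)),
      IsLatticeWithVol G (L ^ d) ∧ IsFundDom G D ∧ AdmissiblePart₀ D E ∧
      sInf {c : ℝ≥0∞ | ∃ (G' D' : Set (Vd d)) (E' : Fin N → Set (Vd d)),
          IsLatticeWithVol G' (L ^ d) ∧ IsFundDom G' D' ∧ AdmissiblePart₀ D' E' ∧
          c = ENNReal.ofReal μ * nlPer K D' + ∑ i, (2⁻¹ * nlPer K (E' i) +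
            ENNReal.ofReal lam * ediff (volume (E' i)) (ENNReal.ofReal (v i)))} =
        ENNReal.ofReal μ * nlPer K D + ∑ i, (2⁻¹ * nlPer K (E i) +
          ENNReal.ofReal lam * ediff (volume (E i)) (ENNReal.ofReal (v i))) := by
  set V : ℝ≥0∞ := ENNReal.ofReal (L ^ d)
  have hLd : 0 < L ^ d := pow_pos hL d
  have hV0 : V ≠ 0 := (ENNReal.ofReal_pos.2 hLd).ne'
  set val : Set (Vd d) → (Fin N → Set (Vd d)) → ℝ≥0∞ := fun D E =>
    ENNReal.ofReal μ * nlPer K D + ∑ i, (2⁻¹ * nlPer K (E i) +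
      ENNReal.ofReal lam * ediff (volume (E i)) (ENNReal.ofReal (v i))) with hval
  set S : Set ℝ≥0∞ := {c : ℝ≥0∞ | ∃ (G' D' : Set (Vd d)) (E' : Fin N → Set (Vd d)),
    IsLatticeWithVol G' (L ^ d) ∧ IsFundDom G' D' ∧ AdmissiblePart₀ D' E' ∧ c = val D' E'} with hS
  suffices hmain : ∃ (G : Set (Vd d)) (D : Set (Vd d)) (E : Fin N → Set (Vd d)),
      IsLatticeWithVol G (L ^ d) ∧ IsFundDom G D ∧ AdmissiblePart₀ D E ∧ val D E ≤ sInf S by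
    obtain ⟨G, D, E, hG, hD, hE, hle⟩ := hmain
    exact ⟨G, D, E, hG, hD, hE, le_antisymm (sInf_le ⟨G, D, E, hG, hD, hE, rfl⟩) hle⟩
  obtain ⟨G₁, D₁, E₁, hG₁, hD₁, hE₁⟩ : ∃ (G : Set (Vd d)) (D : Set (Vd d))
      (E : Fin N → Set (Vd d)),
      IsLatticeWithVol G (L ^ d) ∧ IsFundDom G D ∧ AdmissiblePart₀ D E := by
    obtain ⟨B, hB⟩ := exists_basis_covolume (d := d) hL
    obtain ⟨k, -, -⟩ := Finset.exists_ne_zero_of_sum_ne_zero (hsum.trans_ne hLd.ne')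
    exact ⟨zLat B, _, _, isLatticeWithVol_zLat hLd.le B hB, isFundDom_of_zSpan B,
      admissiblePart₀_single (ZSpan.fundamentalDomain_measurableSet B) k⟩
  by_cases htop : sInf S = ⊤
  · exact ⟨G₁, D₁, E₁, hG₁, hD₁, hE₁, htop ▸ le_top⟩
  obtain ⟨u, hanti, hu, huS⟩ := exists_seq_tendsto_sInf
    (S := S) ⟨_, G₁, D₁, E₁, hG₁, hD₁, hE₁, rfl⟩ (OrderBot.bddBelow S)
  obtain ⟨n₀, hn₀⟩ := (hu.eventually (gt_mem_nhds (lt_top_iff_ne_top.2 htop))).exists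
  choose G D E hG hD hE huval using fun n => huS (n + n₀)
  have huM : ∀ n, val (D n) (E n) ≤ u n₀ := fun n => by
    rw [← huval]
    exact hanti (Nat.le_add_left _ _)
  choose B hGB hBV using fun n => (hG n).exists_basis
  have hEM : ∀ n i, nlPer K (E n i) ≤ 2 * u n₀ := by
    intro n i
    have h1 : 2⁻¹ * nlPer K (E n i) ≤ u n₀ := by
      refine le_trans ?_ (huM n)
      refine le_trans (le_trans le_self_add (Finset.single_le_sum
        (f := fun i => 2⁻¹ * nlPer K (E n i) +
          ENNReal.ofReal lam * ediff (volume (E n i)) (ENNReal.ofReal (v i)))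
        (fun _ _ => zero_le) (Finset.mem_univ i))) le_add_self
    calc nlPer K (E n i) = 2 * (2⁻¹ * nlPer K (E n i)) := by
          rw [← mul_assoc, ENNReal.mul_inv_cancel two_ne_zero ENNReal.ofNat_ne_top, one_mul]
      _ ≤ 2 * u n₀ := by gcongr
  set M : ℝ≥0∞ := 2 * u n₀ + N * (2 * u n₀)
  have hM : M ≠ ⊤ := by
    have : 2 * u n₀ ≠ ⊤ := ENNReal.mul_ne_top ENNReal.ofNat_ne_top hn₀.ne
    exact ENNReal.add_ne_top.2 ⟨this, ENNReal.mul_ne_top (ENNReal.natCast_ne_top N) this⟩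
  have hDM : ∀ n, nlPer K (D n) ≤ M := fun n => by
    refine (nlPer_le_sum_of_admissiblePart₀ K (hE n)).trans
      ((Finset.sum_le_sum fun i _ => hEM n i).trans ?_)
    rw [Finset.sum_const, Finset.card_univ, Fintype.card_fin, nsmul_eq_mul]
    exact le_add_self
  obtain ⟨B₀, D₀, E₀, hB₀, hD₀, hE₀, hvol, hEper, hDper⟩ := exists_limit_partition hs.1 hC hK hM
    ENNReal.ofReal_ne_top hV0 (hyperfilter ℕ) hBV (fun n => hGB n ▸ hD n) hE
    (fun n i => (hEM n i).trans le_self_add) hDM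
  refine ⟨zLat B₀, D₀, E₀, isLatticeWithVol_zLat hLd.le B₀ hB₀, hD₀, hE₀, ?_⟩
  choose p hp hpE using fun i => exists_tendsto_ge_of_lsc (hEper i)
  obtain ⟨pD, hpD, hpD₀⟩ := exists_tendsto_ge_of_lsc hDper
  have hlim : Tendsto (fun n => val (D n) (E n)) (hyperfilter ℕ : Filter ℕ)
      (𝓝 (ENNReal.ofReal μ * pD + ∑ i, (2⁻¹ * p i +
        ENNReal.ofReal lam * ediff (volume (E₀ i)) (ENNReal.ofReal (v i))))) := by
    refine (ENNReal.Tendsto.const_mul hpD (Or.inr ENNReal.ofReal_ne_top)).add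
      (tendsto_finsetSum _ fun i _ => ?_)
    exact (ENNReal.Tendsto.const_mul (hp i) (Or.inr (by simp))).add
      (ENNReal.Tendsto.const_mul (tendsto_ediff (hvol i) ENNReal.ofReal_ne_top)
        (Or.inr ENNReal.ofReal_ne_top))
  have hlim' : Tendsto (fun n => val (D n) (E n)) (hyperfilter ℕ : Filter ℕ) (𝓝 (sInf S)) := by
    simp_rw [← huval]
    exact (hu.comp (tendsto_add_atTop_nat n₀)).mono_left Nat.hyperfilter_le_atTop
  rw [tendsto_nhds_unique hlim' hlim]
  simp only [hval]
  gcongr with i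
  exact hpE i

end
end

section
/- Let d ≥ 1, let K be a nonlocal kernel as below, and let Ω ⊆ ℝ^d be open. If (E_n) are Borel subsets of ℝ^d with E_n → E in L^1_loc for a Borel set E, then Per_K(E,Ω) ≤ liminf_{n→∞} Per_K(E_n,Ω). -/
open MeasureTheory Filter Topology
open scoped symmDiff ENNReal

noncomputable section

variable {d : ℕ}

lemma ENNReal.liminf_add_liminf_le_atTop (u v : ℕ → ℝ≥0∞) :
    liminf u atTop + liminf v atTop ≤ liminf (fun n => u n + v n) atTop := by
  simp only [liminf_eq_iSup_iInf_of_nat]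
  rw [ENNReal.iSup_add_iSup_of_monotone]
  · exact iSup_mono fun n => le_iInf₂ fun i hi => add_le_add (iInf₂_le i hi) (iInf₂_le i hi)
  all_goals exact fun m n hmn => le_iInf₂ fun i hi => iInf₂_le i (hmn.trans hi)

lemma TendstoL1loc.exists_subseq_ae_mem_iff {E : ℕ → Set (Vd d)} {F : Set (Vd d)}
    (h : TendstoL1loc E F) {P : ℕ → Prop} (hP : ∃ᶠ n in atTop, P n) :
    ∃ φ : ℕ → ℕ, StrictMono φ ∧ (∀ k, P (φ k)) ∧
      ∀ᵐ x, ∀ᶠ k in atTop, (x ∈ E (φ k) ↔ x ∈ F) := by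
  obtain ⟨ε, hε, hεsum⟩ := ENNReal.exists_pos_sum_of_countable' (ε := 1) one_ne_zero ℕ
  obtain ⟨φ, hφ, hφP⟩ := extraction_forall_of_frequently
    (P := fun k n => P n ∧ volume ((E n ∆ F) ∩ Metric.ball 0 ((k : ℝ) + 1)) < ε k)
    fun k => hP.and_eventually ((h (k + 1) (by positivity)).eventually_lt_const (hε k))
  refine ⟨φ, hφ, fun k => (hφP k).1, ?_⟩
  have hsum : ∑' k, volume ((E (φ k) ∆ F) ∩ Metric.ball 0 ((k : ℝ) + 1)) ≠ ∞ :=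
    ((ENNReal.tsum_le_tsum fun k => (hφP k).2.le).trans_lt
      (hεsum.trans ENNReal.one_lt_top)).ne
  filter_upwards [ae_eventually_notMem hsum] with x hx
  obtain ⟨N, hN⟩ := exists_nat_gt ‖x‖
  filter_upwards [hx, eventually_ge_atTop N] with k hk hNk
  have hball : x ∈ Metric.ball (0 : Vd d) ((k : ℝ) + 1) := by
    have : (N : ℝ) ≤ k := by exact_mod_cast hNk
    rw [mem_ball_zero_iff]
    linarith
  have hk' : x ∉ E (φ k) ∆ F := fun hx' => hk ⟨hx', hball⟩
  rw [Set.mem_symmDiff] at hk'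
  tauto

lemma setLIntegral_setLIntegral_le_liminf {α : Type*} [MeasurableSpace α] {μ : Measure α}
    [SFinite μ] {k : α → α → ℝ≥0∞} (hk : Measurable (Function.uncurry k))
    {A B : ℕ → Set α} {A' B' : Set α} (hA : ∀ n, MeasurableSet (A n))
    (hB : ∀ n, MeasurableSet (B n)) (hA' : MeasurableSet A') (hB' : MeasurableSet B')
    (hAlim : ∀ᵐ x ∂μ, ∀ᶠ n in atTop, (x ∈ A n ↔ x ∈ A'))
    (hBlim : ∀ᵐ x ∂μ, ∀ᶠ n in atTop, (x ∈ B n ↔ x ∈ B')) :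
    ∫⁻ x in A', ∫⁻ y in B', k x y ∂μ ∂μ ≤
      liminf (fun n => ∫⁻ x in A n, ∫⁻ y in B n, k x y ∂μ ∂μ) atTop := by
  have hinner : ∀ x, ∫⁻ y in B', k x y ∂μ ≤ liminf (fun n => ∫⁻ y in B n, k x y ∂μ) atTop := by
    intro x
    have hkx : Measurable (k x) := hk.of_uncurry_left
    simp_rw [← lintegral_indicator hB', ← lintegral_indicator (hB _)]
    refine le_trans (lintegral_mono_ae ?_)
      (lintegral_liminf_le fun n => hkx.indicator (hB n))
    filter_upwards [hBlim] with y hy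
    refine le_liminf_of_le (by isBoundedDefault) ?_
    filter_upwards [hy] with n hn
    by_cases hyB : y ∈ B' <;> simp [hn, hyB]
  have hmeas : ∀ n, Measurable fun x => ∫⁻ y in B n, k x y ∂μ := fun n =>
    hk.lintegral_prod_right'
  simp_rw [← lintegral_indicator hA', ← lintegral_indicator (hA _)]
  refine le_trans (lintegral_mono_ae ?_)
    (lintegral_liminf_le fun n => (hmeas n).indicator (hA n))
  filter_upwards [hAlim] with x hx
  by_cases hxA : x ∈ A'
  · rw [Set.indicator_of_mem hxA]
    refine (hinner x).trans_eq (liminf_congr ?_)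
    filter_upwards [hx] with n hn
    rw [Set.indicator_of_mem (hn.2 hxA)]
  · simp [hxA]

theorem stmt9 {d : ℕ} (hd : 1 ≤ d) (K : Vd d → ℝ≥0∞)
    (hmeas : Measurable K) (hsymm : ∀ x, K (-x) = K x)
    (Ω : Set (Vd d)) (hΩ : IsOpen Ω)
    (E : ℕ → Set (Vd d)) (hE : ∀ n, MeasurableSet (E n))
    (F : Set (Vd d)) (hF : MeasurableSet F) (hconv : TendstoL1loc E F) :
    nlPerRel K F Ω ≤ liminf (fun n => nlPerRel K (E n) Ω) atTop := by
  have hk : Measurable (Function.uncurry fun x y : Vd d => K (x - y)) :=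
    hmeas.comp measurable_sub
  by_contra! hlt
  obtain ⟨c, hc, hcF⟩ := exists_between hlt
  obtain ⟨φ, -, hφc, hφ⟩ := hconv.exists_subseq_ae_mem_iff
    (frequently_lt_of_liminf_lt (by isBoundedDefault) hc)
  refine hcF.not_ge (le_trans ?_ (liminf_le_of_le (by isBoundedDefault)
    (f := atTop) (u := fun n => nlPerRel K (E (φ n)) Ω) fun b hb => ?_))
  · refine le_trans (add_le_add
      (setLIntegral_setLIntegral_le_liminf hk (fun n => (hE (φ n)).inter hΩ.measurableSet)
        (fun n => (hE (φ n)).compl) (hF.inter hΩ.measurableSet) hF.compl ?_ ?_)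
      (setLIntegral_setLIntegral_le_liminf hk (fun n => (hE (φ n)).diff hΩ.measurableSet)
        (fun n => hΩ.measurableSet.diff (hE (φ n))) (hF.diff hΩ.measurableSet)
        (hΩ.measurableSet.diff hF) ?_ ?_)) (ENNReal.liminf_add_liminf_le_atTop _ _)
    all_goals
      filter_upwards [hφ] with x hx
      filter_upwards [hx] with n hn
      simp [hn]
  · obtain ⟨n, hn⟩ := hb.exists
    exact hn.trans (hφc n).le

end
end
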